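/- Let ℓ⁽¹⁾ and ℓ⁽²⁾ be tuples of nonnegative integers indexed by the Dirichlet characters modulo q with |ℓ⁽¹⁾| = |ℓ⁽²⁾| = 2, such that ℓ⁽¹⁾ ≠ ℓ⁽²⁾ and at least one of ℓ⁽¹⁾, ℓ⁽²⁾ is not of the form 2δ^χ for any Dirichlet character χ modulo q (where δ^χ is the tuple with entry 1 at χ and 0 elsewhere). Then, unconditionally, |∫_T^{2T} 𝓛^{ℓ⁽¹⁾}(1/2+it) · conj(𝓛^{ℓ⁽²⁾}(1/2+it)) dt| ≪_q T(log T)³. -/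

import Mathlib

open Complex Filter MeasureTheory Finset HurwitzZeta
open scoped ArithmeticFunction Real Classical

noncomputable section

/-- The finite set of primes `p ≤ X`. -/
def primesUpTo (X : ℝ) : Finset ℕ :=
  (Finset.range (Nat.floor X + 1)).filter (fun p => p.Prime ∧ (p : ℝ) ≤ X)

/-- The finite set of naturals `n ≤ X`. -/
def natsUpTo (X : ℝ) : Finset ℕ :=
  (Finset.range (Nat.floor X + 1)).filter (fun n => (n : ℝ) ≤ X)

/-- Truncated Euler product `P_X(s,χ)`, defined via the primitive character `χ*` inducing `χ`:
`P_X(s,χ) = ∏_{p ∣ q} (1 - χ*(p) p^{-s}) · exp(∑_{n ≤ X} χ*(n) Λ(n) / (n^s log n))`. -/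
def PX {q : ℕ} (X : ℝ) (χ : DirichletCharacter ℂ q) (s : ℂ) : ℂ :=
  (∏ p ∈ q.primeFactors, (1 - χ.primitiveCharacter ((p : ℕ) : ZMod χ.conductor) * (p : ℂ) ^ (-s))) *
    Complex.exp (∑ n ∈ natsUpTo X,
      χ.primitiveCharacter ((n : ℕ) : ZMod χ.conductor) * (Λ n : ℂ) / ((n : ℂ) ^ s * (Real.log n : ℂ)))

/-- `𝓟_X^ℓ(s) = ∏_χ P_X(s,χ)^{ℓ_χ}`. -/
def PXl {q : ℕ} (X : ℝ) (ℓ : DirichletCharacter ℂ q → ℕ) (s : ℂ) : ℂ :=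
  ∏ χ : DirichletCharacter ℂ q, (PX X χ s) ^ (ℓ χ)

/-- A Dirichlet character as an arithmetic function. -/
def chiArith {q : ℕ} (χ : DirichletCharacter ℂ q) : ArithmeticFunction ℂ :=
  ⟨fun n => if n = 0 then 0 else χ ((n : ℕ) : ZMod q), by simp⟩

/-- `d_ℓ`, the coefficients of the Dirichlet series of `𝓛^ℓ(s) = ∏_χ L(s,χ)^{ℓ_χ}`,
i.e. the Dirichlet convolution product `∏_χ χ^{*ℓ_χ}`. -/
def dcoef {q : ℕ} (ℓ : DirichletCharacter ℂ q → ℕ) : ArithmeticFunction ℂ :=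
  ∏ χ : DirichletCharacter ℂ q, (chiArith χ) ^ (ℓ χ)

/-- `P*_X(s,χ) = ∏_{p ≤ X}(1 − χ(p)p^{−s})^{−1} · ∏_{√X < p ≤ X}(1 + χ(p)²/(2p^{2s}))^{−1}`. -/
def PstarX {q : ℕ} (X : ℝ) (χ : DirichletCharacter ℂ q) (s : ℂ) : ℂ :=
  ((primesUpTo X).prod (fun p : ℕ => (1 - χ ((p : ℕ) : ZMod q) * (p : ℂ) ^ (-s))⁻¹)) *
    ((primesUpTo X).filter (fun p : ℕ => Real.sqrt X < (p : ℝ))).prod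
      (fun p : ℕ => (1 + χ ((p : ℕ) : ZMod q) ^ 2 / (2 * (p : ℂ) ^ (2 * s)))⁻¹)

/-- `𝓟*_X^ℓ(s) = ∏_χ P*_X(s,χ)^{ℓ_χ}`. -/
def PstarXl {q : ℕ} (X : ℝ) (ℓ : DirichletCharacter ℂ q → ℕ) (s : ℂ) : ℂ :=
  ∏ χ : DirichletCharacter ℂ q, (PstarX X χ s) ^ (ℓ χ)

/-- `Q_X(s,χ) = ∏_{p ≤ √X}(1 − χ(p)p^{−s}) · ∏_{√X < p ≤ X}(1 − χ(p)p^{−s} + χ(p)²/(2p^{2s}))`. -/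
def QX {q : ℕ} (X : ℝ) (χ : DirichletCharacter ℂ q) (s : ℂ) : ℂ :=
  (((primesUpTo X).filter (fun p : ℕ => (p : ℝ) ≤ Real.sqrt X)).prod
      (fun p : ℕ => 1 - χ ((p : ℕ) : ZMod q) * (p : ℂ) ^ (-s))) *
    ((primesUpTo X).filter (fun p : ℕ => Real.sqrt X < (p : ℝ))).prod
      (fun p : ℕ => 1 - χ ((p : ℕ) : ZMod q) * (p : ℂ) ^ (-s)
        + χ ((p : ℕ) : ZMod q) ^ 2 / (2 * (p : ℂ) ^ (2 * s)))

/-- `𝓠_X^ℓ(s) = ∏_χ Q_X(s,χ)^{ℓ_χ}`. -/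
def QXl {q : ℕ} (X : ℝ) (ℓ : DirichletCharacter ℂ q → ℕ) (s : ℂ) : ℂ :=
  ∏ χ : DirichletCharacter ℂ q, (QX X χ s) ^ (ℓ χ)

/-- `𝓛^ℓ(s) = ∏_χ L(s,χ)^{ℓ_χ}`. -/
def Ll {q : ℕ} [NeZero q] (ℓ : DirichletCharacter ℂ q → ℕ) (s : ℂ) : ℂ :=
  ∏ χ : DirichletCharacter ℂ q, (DirichletCharacter.LFunction χ s) ^ (ℓ χ)

/-- GRH for the Dirichlet L-functions modulo `q`: every zero `ρ` of `L(s,χ)` with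
`0 < Re ρ < 1` satisfies `Re ρ = 1/2`. -/
def GRHmod (q : ℕ) [NeZero q] : Prop :=
  ∀ χ : DirichletCharacter ℂ q, ∀ ρ : ℂ,
    DirichletCharacter.LFunction χ ρ = 0 → 0 < ρ.re → ρ.re < 1 → ρ.re = 1 / 2

end

/-- The kernel `exp (-T |log m - log n|)` has row sums bounded by `1 + O(m / T)`. -/
lemma sum_exp_neg_abs_log_sub_le {T : ℝ} (hT : 2 ≤ T) {m : ℕ} (hm : 0 < m) (s : Finset ℕ)
    (hs : ∀ n ∈ s, 0 < n) :
    ∑ n ∈ s, Real.exp (-T * |Real.log m - Real.log n|) ≤ 1 + 3 * m / T := by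
  have hm' : (0 : ℝ) < m := by exact_mod_cast hm
  have hT0 : 0 < T := by linarith
  obtain ⟨K, hK⟩ : ∃ K : ℕ, ∀ n ∈ s, n < m + 1 + K :=
    ⟨s.sup id, fun n hn => by have := Finset.le_sup (f := id) hn; simp only [id] at this; omega⟩
  have hlow : ∑ i ∈ range m, Real.exp (-T * |Real.log m - Real.log i|) * (if i = 0 then 0 else 1)
      ≤ m / T := by
    have h1 : MonotoneOn (fun x : ℝ => x ^ T) (Set.Icc 0 (0 + (m : ℝ))) := by
      intro x hx y hy hxy
      exact Real.rpow_le_rpow hx.1 hxy hT0.le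
    have h2 := h1.sum_le_integral
    rw [integral_rpow (Or.inl (by linarith)), Real.zero_rpow (by linarith)] at h2
    have h3 : ∑ i ∈ range m, Real.exp (-T * |Real.log m - Real.log i|) * (if i = 0 then 0 else 1)
        ≤ ∑ i ∈ range m, ((0 : ℝ) + i) ^ T * ((m : ℝ) ^ T)⁻¹ := by
      refine Finset.sum_le_sum fun i hi => ?_
      split_ifs with h
      · rw [mul_zero]; positivity
      · have hi' : (0 : ℝ) < i := by exact_mod_cast Nat.pos_of_ne_zero h
        have him : (i : ℝ) ≤ m := by exact_mod_cast (Finset.mem_range.1 hi).le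
        have := Real.log_le_log hi' him
        rw [abs_of_nonneg (by linarith), zero_add, Real.rpow_def_of_pos hi', Real.rpow_def_of_pos hm',
          ← Real.exp_neg, ← Real.exp_add, mul_one]
        exact le_of_eq (by ring_nf)
    refine h3.trans ?_
    rw [← Finset.sum_mul]
    calc _ ≤ (((0 : ℝ) + m) ^ (T + 1) - 0) / (T + 1) * ((m : ℝ) ^ T)⁻¹ := by gcongr
      _ = m / (T + 1) := by
        rw [zero_add, Real.rpow_add_one hm'.ne']
        have : (m : ℝ) ^ T ≠ 0 := (Real.rpow_pos_of_pos hm' T).ne'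
        field_simp
        ring
      _ ≤ m / T := by gcongr; linarith
  have hhigh : ∑ i ∈ range K, Real.exp (-T * |Real.log m - Real.log (m + (i + 1 : ℕ))|)
      ≤ 2 * m / T := by
    have h1 : AntitoneOn (fun x : ℝ => x ^ (-T)) (Set.Icc (m : ℝ) (m + (K : ℝ))) := by
      intro x hx y hy hxy
      exact Real.rpow_le_rpow_of_nonpos (hm'.trans_le hx.1) hxy (by linarith)
    have h2 := h1.sum_le_integral
    rw [integral_rpow (Or.inr ⟨by linarith, by
      rw [Set.uIcc_of_le (by linarith [(Nat.cast_nonneg K : (0 : ℝ) ≤ K)])]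
      intro h; linarith [h.1]⟩)] at h2
    have h3 : ∑ i ∈ range K, Real.exp (-T * |Real.log m - Real.log (m + (i + 1 : ℕ))|)
        = ∑ i ∈ range K, ((m : ℝ) + (i + 1 : ℕ)) ^ (-T) * (m : ℝ) ^ T := by
      refine Finset.sum_congr rfl fun i hi => ?_
      have hi' : (0 : ℝ) < (i + 1 : ℕ) := by positivity
      have := Real.log_le_log hm' (by linarith : (m : ℝ) ≤ m + (i + 1 : ℕ))
      rw [abs_of_nonpos (by linarith), Real.rpow_def_of_pos (by positivity),
        Real.rpow_def_of_pos hm', ← Real.exp_add]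
      congr 1; ring
    rw [h3, ← Finset.sum_mul]
    calc _ ≤ (((m : ℝ) + K) ^ (-T + 1) - (m : ℝ) ^ (-T + 1)) / (-T + 1) * (m : ℝ) ^ T := by gcongr
      _ = ((m : ℝ) ^ (-T + 1) - ((m : ℝ) + K) ^ (-T + 1)) / (T - 1) * (m : ℝ) ^ T := by
        rw [← neg_div_neg_eq]; congr 2 <;> ring
      _ ≤ ((m : ℝ) ^ (-T + 1)) / (T - 1) * (m : ℝ) ^ T := by
        have : 0 ≤ ((m : ℝ) + K) ^ (-T + 1) := by positivity
        have : 0 < T - 1 := by linarith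
        gcongr; linarith
      _ = m / (T - 1) := by
        rw [div_mul_eq_mul_div, ← Real.rpow_add hm']
        rw [neg_add_cancel_comm, Real.rpow_one]
      _ ≤ 2 * m / T := by
        rw [div_le_div_iff₀ (by linarith) hT0]; nlinarith
  have hsub : s ⊆ ((range m).filter (· ≠ 0)) ∪ ({m} ∪ (range K).image (fun i => m + (i + 1))) := by
    intro n hn
    have h1 := hs n hn
    have h2 := hK n hn
    simp only [mem_union, mem_filter, mem_range, mem_singleton, mem_image]
    rcases lt_trichotomy n m with h | h | h
    · exact Or.inl ⟨h, by omega⟩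
    · exact Or.inr (Or.inl h)
    · exact Or.inr (Or.inr ⟨n - m - 1, by omega, by omega⟩)
  set F : ℕ → ℝ := fun n => Real.exp (-T * |Real.log m - Real.log n|) with hF
  have hF0 : ∀ n, 0 ≤ F n := fun n => (Real.exp_pos _).le
  have hun : ∀ a b : Finset ℕ, ∑ n ∈ a ∪ b, F n ≤ ∑ n ∈ a, F n + ∑ n ∈ b, F n := by
    intro a b
    rw [← Finset.sum_union_inter]
    exact le_add_of_nonneg_right (Finset.sum_nonneg fun n _ => hF0 n)
  have e1 : ∑ n ∈ (range m).filter (· ≠ 0), F n ≤ m / T := by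
    refine le_trans (le_of_eq ?_) hlow
    rw [Finset.sum_filter]
    refine Finset.sum_congr rfl fun i _ => ?_
    by_cases h : i = 0 <;> simp [h, hF]
  have e2 : ∑ n ∈ ({m} : Finset ℕ), F n = 1 := by simp [hF]
  have e3 : ∑ n ∈ (range K).image (fun i => m + (i + 1)), F n ≤ 2 * m / T := by
    rw [Finset.sum_image (by intro a _ b _ h; simpa using h)]
    simpa [hF] using hhigh
  calc ∑ n ∈ s, F n ≤ _ := Finset.sum_le_sum_of_subset_of_nonneg hsub fun n _ _ => hF0 n
    _ ≤ m / T + (1 + 2 * m / T) := (hun _ _).trans (add_le_add e1 ((hun _ _).trans (by rw [e2]; gcongr)))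
    _ = 1 + 3 * m / T := by ring

lemma norm_fourier_gaussian_le {T : ℝ} (hT : 0 < T) (u : ℝ) :
    ‖∫ t : ℝ, cexp (I * u * t) * cexp (-((1 / T ^ 2 : ℝ) : ℂ) * t ^ 2)‖
      ≤ 5 * T * Real.exp (-T * |u|) := by
  rw [fourierIntegral_gaussian (by rw [ofReal_re]; positivity), norm_mul]
  have h1 : ‖((π : ℂ) / ((1 / T ^ 2 : ℝ) : ℂ)) ^ (1 / 2 : ℂ)‖ = √π * T := by
    have : ((π : ℂ) / ((1 / T ^ 2 : ℝ) : ℂ)) = ((π * T ^ 2 : ℝ) : ℂ) := by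
      push_cast; field_simp
    rw [this, Complex.norm_cpow_eq_rpow_re_of_pos (by positivity)]
    have : (1 / 2 : ℂ).re = 1 / 2 := by norm_num
    rw [this, ← Real.sqrt_eq_rpow, Real.sqrt_mul (by positivity), Real.sqrt_sq hT.le]
  have h2 : ‖cexp (-(u : ℂ) ^ 2 / (4 * ((1 / T ^ 2 : ℝ) : ℂ)))‖ ≤ Real.exp 1 * Real.exp (-T * |u|) := by
    have : (-(u : ℂ) ^ 2 / (4 * ((1 / T ^ 2 : ℝ) : ℂ))) = ((-(u ^ 2 * T ^ 2 / 4) : ℝ) : ℂ) := by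
      push_cast; field_simp
    rw [this, Complex.norm_exp, ofReal_re, ← Real.exp_add]
    apply Real.exp_le_exp.2
    have := sq_nonneg (T * |u| / 2 - 1)
    have h : |u| ^ 2 = u ^ 2 := sq_abs u
    nlinarith
  rw [h1]
  have h3 : √π ≤ 1.8 := by
    rw [Real.sqrt_le_left (by norm_num)]
    linarith [Real.pi_lt_d2]
  have h4 := Real.exp_one_lt_d9
  calc √π * T * _ ≤ 1.8 * T * (2.75 * Real.exp (-T * |u|)) := by
        gcongr
        refine h2.trans ?_
        gcongr
        linarith
    _ ≤ _ := by
      have : 0 < T * Real.exp (-T * |u|) := by positivity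
      nlinarith

/-- Mean value theorem for Dirichlet polynomials with a Gaussian weight. -/
lemma integral_norm_sq_dirichletPolynomial_le {T : ℝ} (hT : 2 ≤ T) (s : Finset ℕ)
    (hs : ∀ n ∈ s, 0 < n) (c : ℕ → ℂ) :
    ∫ t : ℝ, ‖∑ n ∈ s, c n * cexp (-(I * t * Real.log n))‖ ^ 2 * Real.exp (-(1 / T ^ 2) * t ^ 2)
      ≤ 15 * ∑ n ∈ s, (T + n) * ‖c n‖ ^ 2 := by
  have hT0 : 0 < T := by linarith
  set b : ℝ := 1 / T ^ 2 with hb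
  have hb0 : 0 < b := by positivity
  have hintegral : ∀ u : ℝ, Integrable (fun t : ℝ => cexp (I * u * t) * cexp (-(b : ℂ) * t ^ 2)) := by
    intro u
    have := integrable_exp_neg_mul_sq hb0
    refine this.mono' (by fun_prop) (Eventually.of_forall fun t => ?_)
    rw [norm_mul, Complex.norm_exp, Complex.norm_exp]
    have e1 : (I * u * t).re = 0 := by simp
    have e2 : (-(b : ℂ) * t ^ 2).re = -b * t ^ 2 := by
      rw [← ofReal_pow, ← ofReal_neg, ← ofReal_mul, ofReal_re]
    rw [e1, e2, Real.exp_zero, one_mul]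
  have key : ((∫ t : ℝ, ‖∑ n ∈ s, c n * cexp (-(I * t * Real.log n))‖ ^ 2 * Real.exp (-b * t ^ 2) : ℝ) : ℂ)
      = ∑ m ∈ s, ∑ n ∈ s, c m * starRingEnd ℂ (c n) *
        ∫ t : ℝ, cexp (I * (Real.log n - Real.log m : ℝ) * t) * cexp (-(b : ℂ) * t ^ 2) := by
    rw [← integral_complex_ofReal]
    have : ∀ t : ℝ, ((‖∑ n ∈ s, c n * cexp (-(I * t * Real.log n))‖ ^ 2 * Real.exp (-b * t ^ 2) : ℝ) : ℂ)
        = ∑ m ∈ s, ∑ n ∈ s, c m * starRingEnd ℂ (c n) *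
          (cexp (I * (Real.log n - Real.log m : ℝ) * t) * cexp (-(b : ℂ) * t ^ 2)) := by
      intro t
      rw [ofReal_mul, ofReal_pow, ← Complex.mul_conj', map_sum, Finset.sum_mul_sum, Finset.sum_mul]
      refine Finset.sum_congr rfl fun m _ => ?_
      rw [Finset.sum_mul]
      refine Finset.sum_congr rfl fun n _ => ?_
      have e1 : starRingEnd ℂ (cexp (-(I * t * Real.log n))) = cexp (I * t * Real.log n) := by
        rw [← Complex.exp_conj]; congr 1; simp [-natCast_log]
      have e2 : cexp (I * (Real.log n - Real.log m : ℝ) * t)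
          = cexp (-(I * t * Real.log m)) * cexp (I * t * Real.log n) := by
        rw [← Complex.exp_add]; congr 1; push_cast; ring
      rw [map_mul, e1, e2]
      push_cast
      ring
    simp_rw [this]
    rw [integral_finsetSum _ fun m _ => integrable_finsetSum _ fun n _ => (hintegral _).const_mul _]
    refine Finset.sum_congr rfl fun m _ => ?_
    rw [integral_finsetSum _ fun n _ => (hintegral _).const_mul _]
    refine Finset.sum_congr rfl fun n _ => ?_
    rw [integral_const_mul]
  have h0 : 0 ≤ ∫ t : ℝ, ‖∑ n ∈ s, c n * cexp (-(I * t * Real.log n))‖ ^ 2 * Real.exp (-b * t ^ 2) :=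
    integral_nonneg fun t => by positivity
  rw [← Complex.norm_of_nonneg h0, key]
  set κ : ℕ → ℕ → ℝ := fun m n => Real.exp (-T * |Real.log m - Real.log n|) with hκ
  have hsym : ∀ m n, κ m n = κ n m := fun m n => by simp only [hκ]; rw [abs_sub_comm]
  calc _ ≤ ∑ m ∈ s, ∑ n ∈ s, ‖c m‖ * ‖c n‖ * (5 * T * κ m n) := by
        refine (norm_sum_le _ _).trans (Finset.sum_le_sum fun m _ => (norm_sum_le _ _).trans
          (Finset.sum_le_sum fun n _ => ?_))
        rw [norm_mul, norm_mul, RCLike.norm_conj, hsym]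
        gcongr
        exact norm_fourier_gaussian_le hT0 _
    _ ≤ ∑ m ∈ s, ∑ n ∈ s, (‖c m‖ ^ 2 / 2 * (5 * T * κ m n) + ‖c n‖ ^ 2 / 2 * (5 * T * κ n m)) := by
        refine Finset.sum_le_sum fun m _ => Finset.sum_le_sum fun n _ => ?_
        rw [hsym n m, ← add_mul]
        have : 0 ≤ κ m n := (Real.exp_pos _).le
        gcongr
        nlinarith [sq_nonneg (‖c m‖ - ‖c n‖)]
    _ = ∑ m ∈ s, ‖c m‖ ^ 2 * (5 * T * ∑ n ∈ s, κ m n) := by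
        simp_rw [Finset.sum_add_distrib]
        rw [Finset.sum_comm (f := fun m n => ‖c n‖ ^ 2 / 2 * (5 * T * κ n m)), ← Finset.sum_add_distrib]
        refine Finset.sum_congr rfl fun m _ => ?_
        rw [← Finset.mul_sum, ← Finset.mul_sum]
        ring
    _ ≤ ∑ m ∈ s, ‖c m‖ ^ 2 * (5 * T * (1 + 3 * m / T)) := by
        refine Finset.sum_le_sum fun m hm => ?_
        gcongr
        exact sum_exp_neg_abs_log_sub_le hT (hs m hm) s hs
    _ ≤ _ := by
        rw [Finset.mul_sum]
        refine Finset.sum_le_sum fun m hm => ?_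
        have : 5 * T * (1 + 3 * m / T) = 5 * T + 15 * m := by field_simp; ring
        rw [this]
        nlinarith [sq_nonneg ‖c m‖, mul_nonneg hT0.le (sq_nonneg ‖c m‖)]

lemma integral_mul_le_sqrt_mul_sqrt {f g : ℝ → ℝ} (hf : ∀ t, 0 ≤ f t) (hg : ∀ t, 0 ≤ g t)
    (hfc : Continuous f) (hgc : Continuous g) (hf2 : Integrable fun t => f t ^ 2)
    (hg2 : Integrable fun t => g t ^ 2) :
    ∫ t, f t * g t ≤ √(∫ t, f t ^ 2) * √(∫ t, g t ^ 2) := by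
  have h := integral_mul_le_Lp_mul_Lq_of_nonneg (μ := volume) (Real.HolderConjugate.two_two)
    (Eventually.of_forall hf) (Eventually.of_forall hg)
    (by
      rw [show ENNReal.ofReal 2 = 2 by norm_num]
      exact (memLp_two_iff_integrable_sq hfc.aestronglyMeasurable).2 hf2)
    (by
      rw [show ENNReal.ofReal 2 = 2 by norm_num]
      exact (memLp_two_iff_integrable_sq hgc.aestronglyMeasurable).2 hg2)
  simpa [Real.sqrt_eq_rpow] using h

/-- Log-convexity of the `L²` mean of a holomorphic function on vertical lines. -/
lemma sq_integral_norm_sq_le_of_strip {g : ℂ → ℂ} {ε B : ℝ} (hε : 0 < ε)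
    (hg : ∀ s : ℂ, -1 < s.re → s.re < 2 → DifferentiableAt ℂ g s)
    (hB : ∀ s : ℂ, -(1 / 2) ≤ s.re → s.re ≤ 3 / 2 → ‖g s‖ ≤ B * Real.exp (-ε * s.im ^ 2)) :
    (∫ t : ℝ, ‖g (1 / 2 + t * I)‖ ^ 2) ^ 2
      ≤ (∫ t : ℝ, ‖g (-(1 / 2) + t * I)‖ ^ 2) * ∫ t : ℝ, ‖g (3 / 2 + t * I)‖ ^ 2 := by
  have hB0 : 0 ≤ B := by
    have := (norm_nonneg _).trans (hB 0 (by norm_num) (by norm_num))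
    exact nonneg_of_mul_nonneg_left this (Real.exp_pos _)
  have hBle : ∀ s : ℂ, -(1 / 2) ≤ s.re → s.re ≤ 3 / 2 → ‖g s‖ ≤ B := fun s h1 h2 =>
    (hB s h1 h2).trans (mul_le_of_le_one_right hB0 (Real.exp_le_one_iff.2 (by nlinarith [sq_nonneg s.im])))
  have hline : ∀ z : ℂ, -1 < z.re → z.re < 2 → Continuous fun t : ℝ => g (z + t * I) := by
    intro z h1 h2
    rw [continuous_iff_continuousAt]
    intro t
    have : ContinuousAt g (z + t * I) := (hg _ (by simpa using h1) (by simpa using h2)).continuousAt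
    exact ContinuousAt.comp (f := fun t : ℝ => z + t * I) this (by fun_prop)
  have hgauss := integrable_exp_neg_mul_sq hε
  have hsq : ∀ σ : ℝ, -(1 / 2) ≤ σ → σ ≤ 3 / 2 → Integrable fun t : ℝ => ‖g (σ + t * I)‖ ^ 2 := by
    intro σ h1 h2
    refine (hgauss.const_mul (B * B)).mono'
      ((hline σ (by simp; linarith) (by simp; linarith)).norm.pow 2).aestronglyMeasurable
      (Eventually.of_forall fun t => ?_)
    rw [Real.norm_of_nonneg (by positivity), sq]
    have e1 := hB (σ + t * I) (by simpa using h1) (by simpa using h2)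
    have e2 := hBle (σ + t * I) (by simpa using h1) (by simpa using h2)
    simp only [add_im, ofReal_im, mul_im, ofReal_re, I_im, mul_one, I_re, mul_zero, add_zero,
      zero_add] at e1
    calc _ ≤ B * (B * Real.exp (-ε * t ^ 2)) := mul_le_mul e2 e1 (norm_nonneg _) hB0
      _ = _ := by ring
  set J : ℝ → ℝ := fun σ => ∫ t : ℝ, ‖g (σ + t * I)‖ ^ 2 with hJ
  have hJ0 : ∀ σ, 0 ≤ J σ := fun σ => integral_nonneg fun t => by positivity
  set φ : ℝ → ℂ := fun t => starRingEnd ℂ (g ((1 / 2 : ℝ) + t * I)) with hφ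
  have hφc : Continuous φ := Complex.continuous_conj.comp
    (hline _ (by norm_num) (by norm_num))
  have hφn : ∀ t, ‖φ t‖ = ‖g ((1 / 2 : ℝ) + t * I)‖ := fun t => by simp [hφ]
  have hφB : ∀ t, ‖φ t‖ ≤ B * Real.exp (-ε * t ^ 2) := by
    intro t
    rw [hφn]
    have := hB ((1 / 2 : ℝ) + t * I) (by norm_num) (by norm_num)
    simpa using this
  set G : ℂ → ℂ := fun z => ∫ t : ℝ, g (z + t * I) * φ t with hG
  have hbd_int : Integrable fun t : ℝ => B * (B * Real.exp (-ε * t ^ 2)) :=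
    (hgauss.const_mul B).const_mul B
  have hpt : ∀ z : ℂ, -(1 / 2) ≤ z.re → z.re ≤ 3 / 2 → ∀ t : ℝ,
      ‖g (z + t * I) * φ t‖ ≤ B * (B * Real.exp (-ε * t ^ 2)) := by
    intro z h1 h2 t
    rw [norm_mul]
    exact mul_le_mul (hBle _ (by simpa using h1) (by simpa using h2)) (hφB t) (norm_nonneg _) hB0
  have hGcont : ContinuousOn G (HadamardThreeLines.verticalClosedStrip (-(1 / 2)) (3 / 2)) := by
    refine continuousOn_of_dominated (bound := fun t => B * (B * Real.exp (-ε * t ^ 2)))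
      (fun z hz => ?_) (fun z hz => Eventually.of_forall (hpt z hz.1 hz.2)) hbd_int
      (Eventually.of_forall fun t => ?_)
    · exact ((hline z (by have := hz.1; linarith) (by have := hz.2; linarith)).mul hφc).aestronglyMeasurable
    · intro z hz
      have : ContinuousAt g (z + t * I) :=
        (hg _ (by have := hz.1; simp; linarith) (by have := hz.2; simp; linarith)).continuousAt
      exact ((ContinuousAt.comp (f := fun z : ℂ => z + t * I) this (by fun_prop)).mul
        continuousAt_const).continuousWithinAt
  have hGdiff : DifferentiableOn ℂ G (HadamardThreeLines.verticalStrip (-(1 / 2)) (3 / 2)) := by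
    intro z hz
    have hz1 : -(1 / 2) < z.re := hz.1
    have hz2 : z.re < 3 / 2 := hz.2
    obtain ⟨r, hr, h1, h2⟩ : ∃ r : ℝ, 0 < r ∧ -(1 / 2) ≤ z.re - 2 * r ∧ z.re + 2 * r ≤ 3 / 2 :=
      ⟨min (z.re + 1 / 2) (3 / 2 - z.re) / 2, by
        have : 0 < min (z.re + 1 / 2) (3 / 2 - z.re) := lt_min (by linarith) (by linarith)
        linarith, by linarith [min_le_left (z.re + 1 / 2) (3 / 2 - z.re)],
        by linarith [min_le_right (z.re + 1 / 2) (3 / 2 - z.re)]⟩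
    have hre : ∀ (w : ℂ) (ρ : ℝ) (v : ℂ), v ∈ Metric.closedBall w ρ → |v.re - w.re| ≤ ρ := by
      intro w ρ v hv
      rw [Metric.mem_closedBall, dist_eq_norm] at hv
      exact (by simpa using Complex.abs_re_le_norm (v - w) : |v.re - w.re| ≤ ‖v - w‖).trans hv
    have hdiffat : ∀ w ∈ Metric.ball z r, ∀ t : ℝ, DifferentiableAt ℂ g (w + t * I) := by
      intro w hw t
      have := abs_le.1 (hre _ _ _ (Metric.ball_subset_closedBall hw))
      exact hg _ (by simp; linarith [this.1]) (by simp; linarith [this.2])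
    have := hasDerivAt_integral_of_dominated_loc_of_deriv_le (μ := volume) (𝕜 := ℂ)
      (F := fun w (t : ℝ) => g (w + t * I) * φ t) (F' := fun w (t : ℝ) => deriv g (w + t * I) * φ t)
      (x₀ := z) (s := Metric.ball z r) (bound := fun t => B / r * (B * Real.exp (-ε * t ^ 2)))
      (Metric.ball_mem_nhds z hr)
      (by
        filter_upwards [Metric.ball_mem_nhds z hr] with w hw
        have := abs_le.1 (hre _ _ _ (Metric.ball_subset_closedBall hw))
        exact ((hline w (by linarith [this.1]) (by linarith [this.2])).mul hφc).aestronglyMeasurable)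
      (hbd_int.mono' ((hline z (by linarith) (by linarith)).mul hφc).aestronglyMeasurable
        (Eventually.of_forall (hpt z hz1.le hz2.le)))
      (by
        refine Measurable.aestronglyMeasurable ?_
        exact ((measurable_deriv g).comp (by fun_prop)).mul hφc.measurable)
      (Eventually.of_forall fun t w hw => by
        have hw' := abs_le.1 (hre _ _ _ (Metric.ball_subset_closedBall hw))
        rw [norm_mul]
        refine mul_le_mul ?_ (hφB t) (norm_nonneg _) (by positivity)
        have hin : ∀ v ∈ Metric.closedBall (w + t * I) r, -(1 / 2) ≤ v.re ∧ v.re ≤ 3 / 2 := by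
          intro v hv
          have := abs_le.1 (hre _ _ _ hv)
          simp only [add_re, mul_re, ofReal_re, I_re, mul_zero, ofReal_im, I_im, mul_one,
            sub_self, add_zero] at this
          constructor <;> linarith [this.1, this.2, hw'.1, hw'.2]
        refine Complex.norm_deriv_le_of_forall_mem_sphere_norm_le hr ?_ ?_
        · refine DifferentiableOn.diffContOnCl_ball (U := Metric.closedBall (w + t * I) r)
            (fun v hv => ?_) subset_rfl
          have := hin v hv
          exact (hg v (by linarith [this.1]) (by linarith [this.2])).differentiableWithinAt
        · intro v hv
          have := hin v (Metric.sphere_subset_closedBall hv)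
          exact hBle v this.1 this.2)
      ((hgauss.const_mul B).const_mul (B / r))
      (Eventually.of_forall fun t w hw => by
        have h := (hdiffat w hw t).hasDerivAt
        exact (h.comp_add_const w (t * I)).mul_const (φ t))
    exact this.2.differentiableAt.differentiableWithinAt
  have hd : DiffContOnCl ℂ G (HadamardThreeLines.verticalStrip (-(1 / 2)) (3 / 2)) := by
    refine ⟨hGdiff, hGcont.mono ?_⟩
    refine closure_minimal (fun z hz => ⟨hz.1.le, hz.2.le⟩) ?_
    exact isClosed_Icc.preimage Complex.continuous_re
  have hedge : ∀ σ : ℝ, -(1 / 2) ≤ σ → σ ≤ 3 / 2 → ∀ z ∈ re ⁻¹' {σ},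
      ‖G z‖ ≤ √(J σ) * √(J (1 / 2)) := by
    intro σ h1 h2 z hz
    have hz' : z.re = σ := hz
    have hzz : ∀ t : ℝ, z + t * I = σ + ((t + z.im : ℝ) : ℂ) * I := by
      intro t; apply Complex.ext <;> simp [hz', add_comm]
    have hl := hline z (by rw [hz']; linarith) (by rw [hz']; linarith)
    have hi : Integrable fun t : ℝ => ‖g (z + t * I)‖ ^ 2 := by
      simp_rw [hzz]
      exact (hsq σ h1 h2).comp_add_right z.im
    have hJz : ∫ t : ℝ, ‖g (z + t * I)‖ ^ 2 = J σ := by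
      simp_rw [hzz]
      exact integral_add_right_eq_self (fun t : ℝ => ‖g (σ + t * I)‖ ^ 2) z.im
    calc ‖G z‖ ≤ ∫ t : ℝ, ‖g (z + t * I) * φ t‖ := norm_integral_le_integral_norm _
      _ = ∫ t : ℝ, ‖g (z + t * I)‖ * ‖g ((1 / 2 : ℝ) + t * I)‖ := by simp_rw [norm_mul, hφn]
      _ ≤ √(∫ t : ℝ, ‖g (z + t * I)‖ ^ 2) * √(J (1 / 2)) :=
        integral_mul_le_sqrt_mul_sqrt (fun t => norm_nonneg _) (fun t => norm_nonneg _) hl.norm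
          (hline _ (by norm_num) (by norm_num)).norm hi (hsq (1 / 2) (by norm_num) (by norm_num))
      _ = _ := by rw [hJz]
  have hbdd : BddAbove ((norm ∘ G) '' HadamardThreeLines.verticalClosedStrip (-(1 / 2)) (3 / 2)) := by
    refine ⟨∫ t : ℝ, B * (B * Real.exp (-ε * t ^ 2)), ?_⟩
    rintro _ ⟨z, hz, rfl⟩
    exact norm_integral_le_of_norm_le hbd_int (Eventually.of_forall (hpt z hz.1 hz.2))
  have h3 := HadamardThreeLines.norm_le_interp_of_mem_verticalClosedStrip' (f := G)
    (z := ((1 / 2 : ℝ) : ℂ)) (by norm_num : (-(1 / 2) : ℝ) < 3 / 2)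
    (by constructor <;> rw [ofReal_re] <;> norm_num) hd hbdd (hedge _ le_rfl (by norm_num))
    (hedge _ (by norm_num) le_rfl)
  have hGhalf : G ((1 / 2 : ℝ) : ℂ) = (J (1 / 2) : ℂ) := by
    simp only [hG, hJ, hφ, Complex.mul_conj']
    rw [← integral_complex_ofReal]
    push_cast
    rfl
  rw [hGhalf, Complex.norm_of_nonneg (hJ0 _), ofReal_re,
    show (1 / 2 - (-(1 / 2) : ℝ)) / (3 / 2 - (-(1 / 2))) = 1 / 2 by norm_num,
    show (1 - 1 / 2 : ℝ) = 1 / 2 by norm_num, ← Real.sqrt_eq_rpow, ← Real.sqrt_eq_rpow,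
    ← Real.sqrt_mul (by positivity)] at h3
  have h4 : J (1 / 2) ^ 2 ≤ √(J (-(1 / 2))) * √(J (1 / 2)) * (√(J (3 / 2)) * √(J (1 / 2))) := by
    rw [← Real.sqrt_le_sqrt_iff (by positivity), Real.sqrt_sq (hJ0 _)]
    exact h3
  have h5 : J (1 / 2) ^ 2 ≤ J (-(1 / 2)) * J (3 / 2) := by
    have e1 := Real.mul_self_sqrt (hJ0 (1 / 2))
    have e2 := Real.mul_self_sqrt (hJ0 (-(1 / 2)))
    have e3 := Real.mul_self_sqrt (hJ0 (3 / 2))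
    rcases (hJ0 (1 / 2)).eq_or_lt with h | h
    · rw [← h]; nlinarith [mul_nonneg (hJ0 (-(1 / 2))) (hJ0 (3 / 2))]
    · have h6 : J (1 / 2) ≤ √(J (-(1 / 2))) * √(J (3 / 2)) := by
        refine le_of_mul_le_mul_right ?_ h
        calc J (1 / 2) * J (1 / 2) = J (1 / 2) ^ 2 := by ring
          _ ≤ _ := h4
          _ = √(J (-(1 / 2))) * √(J (3 / 2)) * (√(J (1 / 2)) * √(J (1 / 2))) := by ring
          _ = _ := by rw [e1]
      calc J (1 / 2) ^ 2 ≤ (√(J (-(1 / 2))) * √(J (3 / 2))) ^ 2 := by gcongr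
        _ = (√(J (-(1 / 2))) * √(J (-(1 / 2)))) * (√(J (3 / 2)) * √(J (3 / 2))) := by ring
        _ = _ := by rw [e2, e3]
  simpa [hJ] using h5

/-- Mean value theorem for absolutely convergent Dirichlet series with a Gaussian weight. -/
lemma integral_norm_sq_tsum_le {T : ℝ} (hT : 2 ≤ T) {c : ℕ → ℂ} (hc0 : c 0 = 0)
    (hc : Summable fun n => ‖c n‖) (hc2 : Summable fun n => (T + n) * ‖c n‖ ^ 2) :
    ∫ t : ℝ, ‖∑' n, c n * cexp (-(I * t * Real.log n))‖ ^ 2 * Real.exp (-(1 / T ^ 2) * t ^ 2)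
      ≤ 15 * ∑' n, (T + n) * ‖c n‖ ^ 2 := by
  have hT0 : 0 < T := by linarith
  have hb0 : 0 < 1 / T ^ 2 := by positivity
  have hn : ∀ (n : ℕ) (t : ℝ), ‖c n * cexp (-(I * t * Real.log n))‖ = ‖c n‖ := by
    intro n t
    rw [norm_mul, Complex.norm_exp]
    have e1 : (-(I * t * Real.log n)).re = 0 := by simp [-natCast_log]
    rw [e1, Real.exp_zero, mul_one]
  have hlim : Tendsto (fun k : ℕ => ∫ t : ℝ, ‖∑ n ∈ range k, c n * cexp (-(I * t * Real.log n))‖ ^ 2 *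
      Real.exp (-(1 / T ^ 2) * t ^ 2)) atTop (nhds (∫ t : ℝ, ‖∑' n, c n * cexp (-(I * t * Real.log n))‖ ^ 2 *
      Real.exp (-(1 / T ^ 2) * t ^ 2))) := by
    refine tendsto_integral_of_dominated_convergence
      (fun t => (∑' n, ‖c n‖) ^ 2 * Real.exp (-(1 / T ^ 2) * t ^ 2)) (fun k => ?_)
      ((integrable_exp_neg_mul_sq hb0).const_mul _) (fun k => Eventually.of_forall fun t => ?_)
      (Eventually.of_forall fun t => ?_)
    · exact Continuous.aestronglyMeasurable (by fun_prop)
    · rw [Real.norm_of_nonneg (by positivity)]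
      gcongr
      refine (norm_sum_le _ _).trans ?_
      simp only [hn]
      exact hc.sum_le_tsum _ fun _ _ => norm_nonneg _
    · have : Summable fun n => c n * cexp (-(I * t * Real.log n)) :=
        Summable.of_norm (by simpa only [hn] using hc)
      exact (this.hasSum.tendsto_sum_nat.norm.pow 2).mul_const _
  refine le_of_tendsto' hlim fun k => ?_
  have h1 : ∀ t : ℝ, ∑ n ∈ range k, c n * cexp (-(I * t * Real.log n)) =
      ∑ n ∈ (range k).filter (0 < ·), c n * cexp (-(I * t * Real.log n)) := by
    intro t
    rw [Finset.sum_filter]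
    refine Finset.sum_congr rfl fun n _ => ?_
    rcases Nat.eq_zero_or_pos n with h | h
    · simp [h, hc0]
    · simp [h]
  simp only [h1]
  refine (integral_norm_sq_dirichletPolynomial_le hT _ (by simp) c).trans ?_
  gcongr
  exact hc2.sum_le_tsum _ fun _ _ => by positivity

/-- The local Euler factor of `∑ |(f * g)(n)|² n^(-σ)` for completely multiplicative `f`, `g`. -/
lemma summable_and_tsum_local_le {α β : ℂ} (hα : ‖α‖ ≤ 1) (hβ : ‖β‖ ≤ 1) {x : ℝ} (hx0 : 0 ≤ x)
    (hx1 : x < 1) {u : ℕ → ℂ} (hu0 : u 0 = 1) (hu : ∀ e, u (e + 1) = α * u e + β ^ (e + 1)) :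
    Summable (fun e => ‖u e‖ ^ 2 * x ^ e) ∧
      ∑' e, ‖u e‖ ^ 2 * x ^ e ≤ ((1 - x)⁻¹) ^ 2 * ‖(1 - α * starRingEnd ℂ β * x)⁻¹‖ ^ 2 := by
  set γ := starRingEnd ℂ β with hγ
  have hγ1 : ‖γ‖ ≤ 1 := by rw [hγ, RCLike.norm_conj]; exact hβ
  have hub : ∀ e, ‖u e‖ ≤ e + 1 := by
    intro e
    induction e with
    | zero => simp [hu0]
    | succ e ih =>
      rw [hu]
      calc ‖α * u e + β ^ (e + 1)‖ ≤ ‖α‖ * ‖u e‖ + ‖β‖ ^ (e + 1) := by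
            refine (norm_add_le _ _).trans ?_
            rw [norm_mul, norm_pow]
        _ ≤ 1 * (e + 1) + 1 := by
            gcongr
            exact pow_le_one₀ (norm_nonneg _) hβ
        _ = _ := by push_cast; ring
  have hxn : ‖x‖ < 1 := by rwa [Real.norm_of_nonneg hx0]
  have hgeo : Summable fun e : ℕ => ((e : ℝ) + 1) ^ 2 * x ^ e := by
    have h2 := summable_pow_mul_geometric_of_norm_lt_one 2 hxn
    have h1 := summable_pow_mul_geometric_of_norm_lt_one 1 hxn
    have h0 := summable_pow_mul_geometric_of_norm_lt_one 0 hxn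
    refine ((h2.add (h1.mul_left 2)).add h0).congr fun e => ?_
    ring
  have hBs : Summable fun e => ‖u e‖ ^ 2 * x ^ e := by
    refine Summable.of_nonneg_of_le (fun e => by positivity) (fun e => ?_) hgeo
    gcongr
    exact hub e
  refine ⟨hBs, ?_⟩
  have hCs : Summable fun e => u e * γ ^ e * (x : ℂ) ^ e := by
    refine Summable.of_norm_bounded hgeo fun e => ?_
    rw [norm_mul, norm_mul, norm_pow, norm_pow, Complex.norm_of_nonneg hx0]
    gcongr
    calc ‖u e‖ * ‖γ‖ ^ e ≤ (e + 1) * 1 := by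
          gcongr
          · exact hub e
          · exact pow_le_one₀ (norm_nonneg _) hγ1
      _ ≤ (e + 1) ^ 2 := by nlinarith [(Nat.cast_nonneg e : (0 : ℝ) ≤ e)]
  set b : ℝ := ‖β‖ ^ 2 * x with hb
  have hb0 : 0 ≤ b := by positivity
  have hbx : b ≤ x := by
    have : ‖β‖ ^ 2 ≤ 1 := pow_le_one₀ (norm_nonneg _) hβ
    nlinarith
  have hbγ : (b : ℂ) = β * γ * x := by
    rw [hb, hγ, Complex.mul_conj']; push_cast; rfl
  have hbD : Summable fun e : ℕ => b ^ e := summable_geometric_of_lt_one hb0 (hbx.trans_lt hx1)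
  have hD : ∑' e : ℕ, b ^ e = (1 - b)⁻¹ := tsum_geometric_of_lt_one hb0 (hbx.trans_lt hx1)
  set D := (1 - b)⁻¹ with hDd
  set C := ∑' e, u e * γ ^ e * (x : ℂ) ^ e with hC
  set B := ∑' e, ‖u e‖ ^ 2 * x ^ e with hB
  set z := α * γ * x with hz
  have hD1 : ∑' e : ℕ, b ^ (e + 1) = D - 1 := by
    rw [← hD, hbD.tsum_eq_zero_add]; simp
  have hD1c : ∑' e : ℕ, (b : ℂ) ^ (e + 1) = D - 1 := by
    have := congrArg (fun r : ℝ => (r : ℂ)) hD1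
    simpa [ofReal_tsum] using this
  have hbD1 : Summable fun e : ℕ => b ^ (e + 1) := (summable_nat_add_iff 1).2 hbD
  have hbD1c : Summable fun e : ℕ => (b : ℂ) ^ (e + 1) := by
    have := Complex.ofRealCLM.summable hbD1
    simpa using this
  have hCeq : C = 1 + (z * C + (D - 1)) := by
    conv_lhs => rw [hC, hCs.tsum_eq_zero_add]
    rw [← hD1c, hC, ← tsum_mul_left, ← (hCs.mul_left z).tsum_add hbD1c, hu0]
    congr 1
    · simp
    · refine tsum_congr fun e => ?_
      rw [hu, hbγ, hz]; ring
  have hnorm : ∀ e, ‖u (e + 1)‖ ^ 2 * x ^ (e + 1) = ‖α‖ ^ 2 * x * (‖u e‖ ^ 2 * x ^ e) +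
      (2 * (z * (u e * γ ^ e * (x : ℂ) ^ e)).re + b ^ (e + 1)) := by
    intro e
    have h1 : ‖u (e + 1)‖ ^ 2 = ‖α‖ ^ 2 * ‖u e‖ ^ 2 + 2 * (α * u e * γ ^ (e + 1)).re
        + ‖β‖ ^ (2 * (e + 1)) := by
      rw [hu, ← Complex.normSq_eq_norm_sq, Complex.normSq_add, map_mul, map_pow,
        Complex.normSq_eq_norm_sq, Complex.normSq_eq_norm_sq, Complex.normSq_eq_norm_sq, map_pow,
        ← hγ]
      ring
    have h2 : z * (u e * γ ^ e * (x : ℂ) ^ e) = (α * u e * γ ^ (e + 1)) * ((x ^ (e + 1) : ℝ) : ℂ) := by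
      rw [hz]; push_cast; ring
    rw [h1, h2, Complex.re_mul_ofReal, hb]
    ring
  have hzC : Summable fun e => z * (u e * γ ^ e * (x : ℂ) ^ e) := hCs.mul_left z
  have hBeq : B = 1 + (‖α‖ ^ 2 * x * B + (2 * (z * C).re + (D - 1))) := by
    have hre : Summable fun e => 2 * (z * (u e * γ ^ e * (x : ℂ) ^ e)).re :=
      (Complex.reCLM.summable hzC).mul_left 2
    conv_lhs => rw [hB, hBs.tsum_eq_zero_add]
    have e1 : (z * C).re = ∑' e, (z * (u e * γ ^ e * (x : ℂ) ^ e)).re := by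
      rw [hC, ← tsum_mul_left, Complex.re_tsum hzC]
    rw [← hD1, hB, e1, ← tsum_mul_left, ← tsum_mul_left, ← hre.tsum_add hbD1,
      ← (hBs.mul_left _).tsum_add (hre.add hbD1), hu0]
    congr 1
    · simp
    · exact tsum_congr hnorm
  have hzn : ‖z‖ ≤ x := by
    rw [hz, norm_mul, norm_mul, Complex.norm_of_nonneg hx0]
    have : ‖α‖ * ‖γ‖ ≤ 1 := mul_le_one₀ hα (norm_nonneg _) hγ1
    nlinarith
  have hz1 : 1 - z ≠ 0 := by
    intro h
    have : z = 1 := (sub_eq_zero.1 h).symm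
    rw [this, norm_one] at hzn
    linarith
  have hCv : C = D / (1 - z) := by
    rw [eq_div_iff hz1]; linear_combination hCeq
  have ha : ‖α‖ ^ 2 * x ≤ x := by
    have : ‖α‖ ^ 2 ≤ 1 := pow_le_one₀ (norm_nonneg _) hα
    nlinarith
  have hn1 : 0 < ‖1 - z‖ := norm_pos_iff.2 hz1
  have hre : D + 2 * (z * C).re = D * ((1 - ‖z‖ ^ 2) / ‖1 - z‖ ^ 2) := by
    have e1 : z * C = (z * starRingEnd ℂ (1 - z)) * ((D / ‖1 - z‖ ^ 2 : ℝ) : ℂ) := by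
      have := Complex.mul_conj' (1 - z)
      rw [hCv]
      have h0 : ((‖1 - z‖ : ℝ) : ℂ) ≠ 0 := by exact_mod_cast hn1.ne'
      push_cast
      rw [mul_div_assoc', mul_div_assoc', div_eq_div_iff hz1 (pow_ne_zero 2 h0)]
      linear_combination -z * D * this
    have e2 : (z * starRingEnd ℂ (1 - z)).re = z.re - ‖z‖ ^ 2 := by
      rw [← Complex.normSq_eq_norm_sq, Complex.normSq_apply]
      simp
      ring
    have e3 : ‖1 - z‖ ^ 2 = 1 - 2 * z.re + ‖z‖ ^ 2 := by
      rw [← Complex.normSq_eq_norm_sq, ← Complex.normSq_eq_norm_sq, Complex.normSq_apply,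
        Complex.normSq_apply]
      simp
      ring
    rw [e1, Complex.re_mul_ofReal, e2]
    field_simp
    rw [e3]; ring
  have hDpos : 0 < D := inv_pos.2 (by linarith)
  have hDle : D ≤ (1 - x)⁻¹ := inv_anti₀ (by linarith) (by linarith)
  have hBv : B * (1 - ‖α‖ ^ 2 * x) = D * ((1 - ‖z‖ ^ 2) / ‖1 - z‖ ^ 2) := by
    rw [← hre]; linear_combination hBeq
  have hB0 : 0 ≤ B := tsum_nonneg fun e => by positivity
  rw [norm_inv]
  have h1x : 0 < 1 - x := by linarith
  have hz2 : 0 ≤ 1 - ‖z‖ ^ 2 :=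
    sub_nonneg.2 (pow_le_one₀ (norm_nonneg _) (hzn.trans hx1.le))
  calc B = B * (1 - x) * (1 - x)⁻¹ := by field_simp
    _ ≤ B * (1 - ‖α‖ ^ 2 * x) * (1 - x)⁻¹ := by gcongr
    _ = D * ((1 - ‖z‖ ^ 2) / ‖1 - z‖ ^ 2) * (1 - x)⁻¹ := by rw [hBv]
    _ ≤ (1 - x)⁻¹ * (1 / ‖1 - z‖ ^ 2) * (1 - x)⁻¹ := by
      gcongr
      · linarith [sq_nonneg ‖z‖]
    _ = _ := by field_simp

/-- The Dirichlet convolution of two Dirichlet characters. -/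
noncomputable def charConv {M N : ℕ} (χ : DirichletCharacter ℂ M) (ψ : DirichletCharacter ℂ N) :
    ArithmeticFunction ℂ :=
  toArithmeticFunction (χ ·) * toArithmeticFunction (ψ ·)

lemma charConv_isMultiplicative {M N : ℕ} (χ : DirichletCharacter ℂ M)
    (ψ : DirichletCharacter ℂ N) : (charConv χ ψ).IsMultiplicative :=
  χ.isMultiplicative_toArithmeticFunction.mul ψ.isMultiplicative_toArithmeticFunction

lemma charConv_prime_pow {M N : ℕ} (χ : DirichletCharacter ℂ M) (ψ : DirichletCharacter ℂ N)
    {p : ℕ} (hp : p.Prime) (e : ℕ) :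
    charConv χ ψ (p ^ e) = ∑ i ∈ range (e + 1), χ p ^ i * ψ p ^ (e - i) := by
  rw [charConv, ArithmeticFunction.mul_apply, Nat.sum_divisorsAntidiagonal
    (f := fun a b => toArithmeticFunction (χ ·) a * toArithmeticFunction (ψ ·) b),
    Nat.sum_divisors_prime_pow hp]
  refine Finset.sum_congr rfl fun i hi => ?_
  have hi : i ≤ e := by simpa [Nat.lt_succ_iff] using hi
  rw [Nat.pow_div hi hp.pos, ← DirichletCharacter.apply_eq_toArithmeticFunction_apply _
    (pow_ne_zero _ hp.ne_zero), ← DirichletCharacter.apply_eq_toArithmeticFunction_apply _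
    (pow_ne_zero _ hp.ne_zero)]
  simp

lemma charConv_prime_pow_succ {M N : ℕ} (χ : DirichletCharacter ℂ M) (ψ : DirichletCharacter ℂ N)
    {p : ℕ} (hp : p.Prime) (e : ℕ) :
    charConv χ ψ (p ^ (e + 1)) = χ p * charConv χ ψ (p ^ e) + ψ p ^ (e + 1) := by
  rw [charConv_prime_pow _ _ hp, charConv_prime_pow _ _ hp, Finset.sum_range_succ', Finset.mul_sum]
  congr 1
  · refine Finset.sum_congr rfl fun i _ => ?_
    rw [Nat.add_sub_add_right]; ring
  · simp

/-- Rankin-Selberg type bound for the Dirichlet convolution of two characters. -/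
lemma summable_and_tsum_norm_sq_charConv_le {M N K : ℕ} (χ : DirichletCharacter ℂ M)
    (ψ : DirichletCharacter ℂ N) (θ : DirichletCharacter ℂ K)
    (hθ : ∀ n : ℕ, θ n = χ n * starRingEnd ℂ (ψ n)) {σ : ℝ} (hσ : 1 < σ) :
    Summable (fun n : ℕ => ‖charConv χ ψ n‖ ^ 2 * (n : ℝ) ^ (-σ)) ∧
      ∑' n : ℕ, ‖charConv χ ψ n‖ ^ 2 * (n : ℝ) ^ (-σ) ≤
        ‖riemannZeta σ‖ ^ 2 * ‖LSeries (θ ·) σ‖ ^ 2 := by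
  set b : ℕ → ℝ := fun n => ‖charConv χ ψ n‖ ^ 2 * (n : ℝ) ^ (-σ) with hb
  have hσ' : 1 < (σ : ℂ).re := by simpa using hσ
  have hb0 : ∀ n, 0 ≤ b n := fun n => by positivity
  have hm := charConv_isMultiplicative χ ψ
  have hb1 : b 1 = 1 := by simp [hb, hm.map_one]
  have hbm : ∀ {m n : ℕ}, m.Coprime n → b (m * n) = b m * b n := by
    intro m n h
    simp only [hb]
    rw [hm.map_mul_of_coprime h, norm_mul, Nat.cast_mul, Real.mul_rpow (by positivity) (by positivity)]
    ring
  have hbp : ∀ p : ℕ, ∀ e : ℕ, b (p ^ e) = ‖charConv χ ψ (p ^ e)‖ ^ 2 * ((p : ℝ) ^ (-σ)) ^ e := by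
    intro p e
    simp only [hb]
    rw [Nat.cast_pow, ← Real.rpow_natCast (p : ℝ), ← Real.rpow_natCast ((p : ℝ) ^ (-σ)),
      ← Real.rpow_mul (by positivity), ← Real.rpow_mul (by positivity), mul_comm (-σ)]
  set F : ℕ → ℂ := fun p => (1 - (p : ℂ) ^ (-(σ : ℂ)))⁻¹ with hF
  set G : ℕ → ℂ := fun p => (1 - θ p * (p : ℂ) ^ (-(σ : ℂ)))⁻¹ with hG
  have hloc : ∀ {p : ℕ}, p.Prime → Summable (fun e => b (p ^ e)) ∧ ∑' e, b (p ^ e) ≤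
      ‖F p‖ ^ 2 * ‖G p‖ ^ 2 := by
    intro p hp
    have hp0 : (0 : ℝ) < p := by exact_mod_cast hp.pos
    have hx1 : (p : ℝ) ^ (-σ) < 1 :=
      Real.rpow_lt_one_of_one_lt_of_neg (by exact_mod_cast hp.one_lt) (by linarith)
    have := summable_and_tsum_local_le (χ.norm_le_one p) (ψ.norm_le_one p)
      (Real.rpow_nonneg hp0.le (-σ)) hx1 (u := fun e => charConv χ ψ (p ^ e))
      (by simp [hm.map_one]) (charConv_prime_pow_succ χ ψ hp)
    simp only [hbp, hF, hG]
    have e1 : (p : ℂ) ^ (-(σ : ℂ)) = ((p : ℝ) ^ (-σ) : ℝ) := by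
      rw [Complex.ofReal_cpow hp0.le]; simp
    rw [e1, hθ p]
    refine ⟨this.1, this.2.trans (le_of_eq ?_)⟩
    congr 2
    rw [norm_inv, ← ofReal_one, ← ofReal_sub, Complex.norm_of_nonneg (by linarith)]
  have hpart : ∀ n : ℕ, ∑ i ∈ range n, b i ≤ ‖∏ p ∈ n.primesBelow, F p‖ ^ 2 *
      ‖∏ p ∈ n.primesBelow, G p‖ ^ 2 := by
    intro n
    obtain ⟨h1, h2⟩ := EulerProduct.summable_and_hasSum_smoothNumbers_prod_primesBelow_tsum hb1 hbm
      (fun {p} hp => by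
        refine (hloc hp).1.congr fun e => ?_
        rw [Real.norm_of_nonneg (hb0 _)]) n
    calc ∑ i ∈ range n, b i ≤ ∏ p ∈ n.primesBelow, ∑' e, b (p ^ e) := by
          rw [← h2.tsum_eq, tsum_subtype (s := n.smoothNumbers) (f := b)]
          have h3 : ∑ i ∈ range n, b i = ∑ i ∈ range n, (n.smoothNumbers.indicator b) i := by
            refine Finset.sum_congr rfl fun i hi => ?_
            rcases Nat.eq_zero_or_pos i with h | h
            · rw [h, Set.indicator_of_notMem (by simp [Nat.smoothNumbers])]
              simp [hb]
            · rw [Set.indicator_of_mem (Nat.mem_smoothNumbers_of_lt h (Finset.mem_range.1 hi))]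
          rw [h3]
          have h4 : Summable (n.smoothNumbers.indicator b) :=
            summable_subtype_iff_indicator.1 h2.summable
          exact h4.sum_le_tsum (range n) fun i _ => Set.indicator_apply_nonneg fun _ => hb0 i
      _ ≤ ∏ p ∈ n.primesBelow, ‖F p‖ ^ 2 * ‖G p‖ ^ 2 :=
        Finset.prod_le_prod (fun p _ => tsum_nonneg fun _ => hb0 _)
          fun p hp => (hloc (Nat.prime_of_mem_primesBelow hp)).2
      _ = _ := by
        rw [Finset.prod_mul_distrib, Finset.prod_pow, Finset.prod_pow, norm_prod, norm_prod]
  have hlim := ((riemannZeta_eulerProduct hσ').norm.pow 2).mul ((θ.LSeries_eulerProduct hσ').norm.pow 2)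
  have hfin : ∀ n : ℕ, ∑ i ∈ range n, b i ≤ ‖riemannZeta σ‖ ^ 2 * ‖LSeries (θ ·) σ‖ ^ 2 := by
    intro n
    refine ge_of_tendsto hlim ?_
    filter_upwards [eventually_ge_atTop n] with m hmn
    exact (Finset.sum_le_sum_of_subset_of_nonneg (Finset.range_subset_range.2 hmn)
      fun i _ _ => hb0 i).trans (hpart m)
  exact ⟨summable_of_sum_range_le hb0 hfin, Real.tsum_le_of_sum_range_le hb0 hfin⟩

/-- `(s - 1) L(s, χ)`, extended to an entire function. -/
noncomputable def regularizedLFunction {N : ℕ} [NeZero N] (χ : DirichletCharacter ℂ N) : ℂ → ℂ :=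
  Function.update (fun s => (s - 1) * χ.LFunction s) 1 (∑ j, χ j / N)

lemma regularizedLFunction_of_ne_one {N : ℕ} [NeZero N] (χ : DirichletCharacter ℂ N) {s : ℂ}
    (hs : s ≠ 1) : regularizedLFunction χ s = (s - 1) * χ.LFunction s :=
  Function.update_of_ne hs _ _

lemma differentiable_regularizedLFunction {N : ℕ} [NeZero N] (χ : DirichletCharacter ℂ N) :
    Differentiable ℂ (regularizedLFunction χ) := by
  rw [← differentiableOn_univ,
    ← Complex.differentiableOn_compl_singleton_and_continuousAt_iff (c := 1) univ_mem]
  constructor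
  · intro s hs
    have hs1 : s ≠ 1 := by simpa using hs
    have h : DifferentiableAt ℂ (fun s => (s - 1) * χ.LFunction s) s :=
      (by fun_prop : DifferentiableAt ℂ (fun s : ℂ => s - 1) s).mul
        (χ.differentiableAt_LFunction s (Or.inl hs1))
    refine (h.congr_of_eventuallyEq ?_).differentiableWithinAt
    filter_upwards [isOpen_ne.mem_nhds hs1] with z hz using regularizedLFunction_of_ne_one χ hz
  · rw [regularizedLFunction, continuousAt_update_same]
    exact ZMod.LFunction_residue_one χ

lemma exists_norm_LFunction_le_div {N : ℕ} [NeZero N] (χ : DirichletCharacter ℂ N) :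
    ∃ C : ℝ, 0 < C ∧ ∀ σ : ℝ, 1 < σ → σ ≤ 2 → ‖χ.LFunction σ‖ ≤ C / (σ - 1) := by
  obtain ⟨C, hC⟩ := (isCompact_Icc (a := (1 : ℝ)) (b := 2)).exists_bound_of_continuousOn
    (f := fun σ : ℝ => regularizedLFunction χ σ)
    ((differentiable_regularizedLFunction χ).continuous.comp continuous_ofReal).continuousOn
  refine ⟨max C 1, by positivity, fun σ h1 h2 => ?_⟩
  have h3 := hC σ ⟨h1.le, h2⟩
  have h4 : (σ : ℂ) ≠ 1 := by exact_mod_cast h1.ne'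
  have h5 : ‖(σ : ℂ) - 1‖ = σ - 1 := by
    rw [← ofReal_one, ← ofReal_sub, Complex.norm_of_nonneg (by linarith)]
  rw [regularizedLFunction_of_ne_one _ h4, norm_mul, h5] at h3
  rw [le_div_iff₀ (by linarith), mul_comm]
  exact h3.trans (le_max_left _ _)

lemma exists_norm_LFunction_le_of_ne_one {N : ℕ} [NeZero N] {χ : DirichletCharacter ℂ N}
    (hχ : χ ≠ 1) : ∃ C : ℝ, 0 < C ∧ ∀ σ : ℝ, 1 < σ → σ ≤ 2 → ‖χ.LFunction σ‖ ≤ C := by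
  obtain ⟨C, hC⟩ := (isCompact_Icc (a := (1 : ℝ)) (b := 2)).exists_bound_of_continuousOn
    (f := fun σ : ℝ => χ.LFunction σ)
    ((DirichletCharacter.differentiable_LFunction hχ).continuous.comp continuous_ofReal).continuousOn
  exact ⟨max C 1, by positivity, fun σ h1 h2 => (hC σ ⟨h1.le, h2⟩).trans (le_max_left _ _)⟩

/-- The character modulo `M * N` given by `χ * conj ψ`. -/
lemma exists_character_mul_conj {M N : ℕ} [NeZero M] [NeZero N] (χ : DirichletCharacter ℂ M)
    (ψ : DirichletCharacter ℂ N) (n : ℕ) :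
    (DirichletCharacter.changeLevel (dvd_mul_right M N) χ *
      (DirichletCharacter.changeLevel (dvd_mul_left N M) ψ)⁻¹) n = χ n * starRingEnd ℂ (ψ n) := by
  by_cases h : n.Coprime (M * N)
  · have h' : IsCoprime (n : ℤ) ((M * N : ℕ) : ℤ) := Nat.isCoprime_iff_coprime.2 h
    have e1 := DirichletCharacter.changeLevel_eq_cast_of_dvd' χ (dvd_mul_right M N) h'
    have e2 := DirichletCharacter.changeLevel_eq_cast_of_dvd' ψ (dvd_mul_left N M) h'
    rw [Int.cast_natCast, Int.cast_natCast] at e1 e2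
    rw [MulChar.mul_apply, ← MulChar.star_apply', e1, e2, RCLike.star_def]
  · rw [MulChar.map_nonunit _ (by rwa [ZMod.isUnit_iff_coprime])]
    rw [Nat.coprime_mul_iff_right, not_and_or] at h
    rcases h with h | h
    · rw [χ.map_nonunit (by rwa [ZMod.isUnit_iff_coprime]), zero_mul]
    · rw [ψ.map_nonunit (by rwa [ZMod.isUnit_iff_coprime]), map_zero, mul_zero]

lemma exists_tsum_norm_sq_charConv_le {M N : ℕ} [NeZero M] [NeZero N] (χ : DirichletCharacter ℂ M)
    (ψ : DirichletCharacter ℂ N) :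
    ∃ C : ℝ, 0 < C ∧ ∀ σ : ℝ, 1 < σ → σ ≤ 2 →
      Summable (fun n : ℕ => ‖charConv χ ψ n‖ ^ 2 * (n : ℝ) ^ (-σ)) ∧
      ∑' n : ℕ, ‖charConv χ ψ n‖ ^ 2 * (n : ℝ) ^ (-σ) ≤ C * (1 / (σ - 1)) ^ 4 := by
  obtain ⟨C₁, hC₁, h1⟩ := exists_norm_LFunction_le_div (1 : DirichletCharacter ℂ 1)
  obtain ⟨C₂, hC₂, h2⟩ := exists_norm_LFunction_le_div
    (DirichletCharacter.changeLevel (dvd_mul_right M N) χ *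
      (DirichletCharacter.changeLevel (dvd_mul_left N M) ψ)⁻¹)
  refine ⟨C₁ ^ 2 * C₂ ^ 2, by positivity, fun σ hσ hσ2 => ?_⟩
  obtain ⟨h3, h4⟩ := summable_and_tsum_norm_sq_charConv_le χ ψ _ (exists_character_mul_conj χ ψ) hσ
  refine ⟨h3, h4.trans ?_⟩
  have h5 := h1 σ hσ hσ2
  have h6 := h2 σ hσ hσ2
  rw [DirichletCharacter.LFunction_modOne_eq] at h5
  rw [DirichletCharacter.LFunction_eq_LSeries _ (by simpa using hσ)] at h6
  calc _ ≤ (C₁ / (σ - 1)) ^ 2 * (C₂ / (σ - 1)) ^ 2 := by gcongr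
    _ = _ := by ring

lemma exists_tsum_norm_sq_charConv_le_of_ne {M N q : ℕ} [NeZero M] [NeZero N] [NeZero q]
    (χ : DirichletCharacter ℂ M) (ψ : DirichletCharacter ℂ N) (hM : M ∣ q) (hN : N ∣ q)
    (hne : DirichletCharacter.changeLevel hM χ ≠ DirichletCharacter.changeLevel hN ψ) :
    ∃ C : ℝ, 0 < C ∧ ∀ σ : ℝ, 1 < σ → σ ≤ 2 →
      ∑' n : ℕ, ‖charConv χ ψ n‖ ^ 2 * (n : ℝ) ^ (-σ) ≤ C * (1 / (σ - 1)) ^ 2 := by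
  have hθ : DirichletCharacter.changeLevel (dvd_mul_right M N) χ *
      (DirichletCharacter.changeLevel (dvd_mul_left N M) ψ)⁻¹ ≠ 1 := by
    intro h
    rw [mul_inv_eq_one] at h
    apply hne
    have hq : q ∣ q * (M * N) := dvd_mul_right _ _
    have hq' : M * N ∣ q * (M * N) := dvd_mul_left _ _
    apply DirichletCharacter.changeLevel_injective hq
    rw [← DirichletCharacter.changeLevel_trans, ← DirichletCharacter.changeLevel_trans]
    have := congrArg (DirichletCharacter.changeLevel hq') h
    rwa [← DirichletCharacter.changeLevel_trans, ← DirichletCharacter.changeLevel_trans] at this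
  obtain ⟨C₁, hC₁, h1⟩ := exists_norm_LFunction_le_div (1 : DirichletCharacter ℂ 1)
  obtain ⟨C₂, hC₂, h2⟩ := exists_norm_LFunction_le_of_ne_one hθ
  refine ⟨C₁ ^ 2 * C₂ ^ 2, by positivity, fun σ hσ hσ2 => ?_⟩
  obtain ⟨h3, h4⟩ := summable_and_tsum_norm_sq_charConv_le χ ψ _ (exists_character_mul_conj χ ψ) hσ
  refine h4.trans ?_
  have h5 := h1 σ hσ hσ2
  have h6 := h2 σ hσ hσ2
  rw [DirichletCharacter.LFunction_modOne_eq] at h5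
  rw [DirichletCharacter.LFunction_eq_LSeries _ (by simpa using hσ)] at h6
  calc _ ≤ (C₁ / (σ - 1)) ^ 2 * C₂ ^ 2 := by gcongr
    _ = _ := by ring

lemma rpow_inv_log_self {T : ℝ} (hT : 1 < T) : T ^ (1 / Real.log T) = Real.exp 1 := by
  have := Real.log_pos hT
  rw [Real.rpow_def_of_pos (by linarith), mul_one_div_cancel this.ne']

lemma rankin_weight_inv_le {T x : ℝ} (hT : 1 < T) (hx : 0 < x) (hxT : x ≤ T) :
    (T + x) * x⁻¹ ≤ 6 * T * x ^ (-(1 + 1 / Real.log T)) := by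
  have hl := Real.log_pos hT
  have h1 : x ^ (-(1 + 1 / Real.log T)) = x⁻¹ * (x ^ (1 / Real.log T))⁻¹ := by
    rw [Real.rpow_neg hx.le, Real.rpow_add hx, Real.rpow_one, mul_inv]
  have h2 : x ^ (1 / Real.log T) ≤ 3 := by
    calc _ ≤ T ^ (1 / Real.log T) := Real.rpow_le_rpow hx.le hxT (by positivity)
      _ ≤ 3 := by rw [rpow_inv_log_self hT]; linarith [Real.exp_one_lt_d9]
  have h3 : 0 < x ^ (1 / Real.log T) := by positivity
  have h4 : 1 / 3 ≤ (x ^ (1 / Real.log T))⁻¹ := by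
    rw [one_div]; exact inv_anti₀ h3 h2
  rw [h1]
  calc (T + x) * x⁻¹ ≤ (2 * T) * x⁻¹ := by gcongr; linarith
    _ = 6 * T * (x⁻¹ * (1 / 3)) := by ring
    _ ≤ _ := by gcongr

lemma rankin_weight_le {T x : ℝ} (hT : 1 < T) (hx : 0 < x) (hxT : x ≤ T) :
    (T + x) * x ≤ 6 * T ^ 3 * x ^ (-(1 + 1 / Real.log T)) := by
  have := rankin_weight_inv_le hT hx hxT
  calc (T + x) * x = x ^ 2 * ((T + x) * x⁻¹) := by field_simp
    _ ≤ T ^ 2 * (6 * T * x ^ (-(1 + 1 / Real.log T))) := by gcongr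
    _ = _ := by ring

lemma rankin_weight_tail_le {T x : ℝ} (hT : 3 ≤ T) (hxT : T < x) :
    (T + x) * (x ^ 3)⁻¹ ≤ 6 * T⁻¹ * x ^ (-(1 + 1 / Real.log T)) := by
  have hx : 0 < x := by linarith
  have hl : 1 ≤ Real.log T := by
    rw [Real.le_log_iff_exp_le (by linarith)]; linarith [Real.exp_one_lt_d9]
  have h1 : x ^ (-(1 + 1 / Real.log T)) = (x ^ 2)⁻¹ * x ^ (1 - 1 / Real.log T) := by
    rw [← Real.rpow_natCast, ← Real.rpow_neg hx.le, ← Real.rpow_add hx]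
    congr 1; push_cast; ring
  have h2 : T / 3 ≤ x ^ (1 - 1 / Real.log T) := by
    calc T / 3 ≤ T / Real.exp 1 := by
          gcongr
          linarith [Real.exp_one_lt_d9]
      _ = T ^ (1 - 1 / Real.log T) := by
        rw [Real.rpow_sub (by linarith), Real.rpow_one, rpow_inv_log_self (by linarith)]
      _ ≤ _ := by
        refine Real.rpow_le_rpow (by linarith) hxT.le ?_
        rw [sub_nonneg, div_le_one (by linarith)]
        exact hl
  rw [h1]
  have hT0 : 0 < T := by linarith
  calc (T + x) * (x ^ 3)⁻¹ ≤ (2 * x) * (x ^ 3)⁻¹ := by gcongr; linarith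
    _ = 6 * T⁻¹ * ((x ^ 2)⁻¹ * (T / 3)) := by field_simp; norm_num
    _ ≤ _ := by gcongr

lemma norm_Gamma_le_Gamma_re {z : ℂ} (hz : 0 < z.re) : ‖Complex.Gamma z‖ ≤ Real.Gamma z.re := by
  rw [Complex.Gamma_eq_integral hz, Real.Gamma_eq_integral hz, Complex.GammaIntegral]
  refine (norm_integral_le_integral_norm _).trans (le_of_eq ?_)
  refine setIntegral_congr_fun measurableSet_Ioi fun x hx => ?_
  rw [Set.mem_Ioi] at hx
  simp only [norm_mul]
  rw [Complex.norm_of_nonneg (Real.exp_pos _).le, Complex.norm_cpow_eq_rpow_re_of_pos hx]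
  simp

lemma exists_norm_Gamma_le {a : ℝ} (ha : 0 < a) (b : ℝ) :
    ∃ C : ℝ, 0 < C ∧ ∀ z : ℂ, a ≤ z.re → z.re ≤ b → ‖Complex.Gamma z‖ ≤ C := by
  obtain ⟨C, hC⟩ := (isCompact_Icc (a := a) (b := b)).exists_bound_of_continuousOn
    (f := Real.Gamma) (fun x hx => (Real.differentiableAt_Gamma (fun m h => by
      have := hx.1
      have : (0 : ℝ) ≤ m := Nat.cast_nonneg m
      linarith)).continuousAt.continuousWithinAt)
  refine ⟨max C 1, by positivity, fun z h1 h2 => ?_⟩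
  exact (norm_Gamma_le_Gamma_re (ha.trans_le h1)).trans
    ((le_abs_self _).trans ((hC _ ⟨h1, h2⟩).trans (le_max_left _ _)))

lemma norm_sin_le_exp_abs_im (w : ℂ) : ‖Complex.sin w‖ ≤ Real.exp |w.im| := by
  rw [Complex.sin, norm_div, norm_mul, Complex.norm_I, mul_one, Complex.norm_ofNat,
    div_le_iff₀ two_pos]
  refine (norm_sub_le _ _).trans ?_
  rw [Complex.norm_exp, Complex.norm_exp]
  have e1 : (-w * I).re = w.im := by simp
  have e2 : (w * I).re = -w.im := by simp
  rw [e1, e2]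
  linarith [Real.exp_le_exp.2 (le_abs_self w.im), Real.exp_le_exp.2 (neg_le_abs w.im)]

lemma exists_norm_inv_Gamma_le {a b : ℝ} (hb : b < 1) :
    ∃ C : ℝ, 0 < C ∧ ∀ z : ℂ, a ≤ z.re → z.re ≤ b →
      ‖(Complex.Gamma z)⁻¹‖ ≤ C * Real.exp (π * |z.im|) := by
  obtain ⟨C, hC, h⟩ := exists_norm_Gamma_le (a := 1 - b) (by linarith) (1 - a)
  refine ⟨C, hC, fun z h1 h2 => ?_⟩
  have h3 := h (1 - z) (by simp; linarith) (by simp; linarith)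
  have hG : Complex.Gamma (1 - z) ≠ 0 := by
    apply Complex.Gamma_ne_zero_of_re_pos
    simp; linarith
  have h4 : (Complex.Gamma z)⁻¹ = Complex.Gamma (1 - z) * (Complex.sin (π * z) / π) := by
    have := Complex.Gamma_mul_Gamma_one_sub z
    have h5 : (Complex.Gamma z) = ((π : ℂ) / Complex.sin (π * z)) / Complex.Gamma (1 - z) := by
      rw [eq_div_iff hG, this]
    rw [h5, inv_div, div_eq_mul_inv, inv_div]
  have h5 : ‖Complex.sin (π * z) / π‖ ≤ Real.exp (π * |z.im|) := by
    rw [norm_div, Complex.norm_of_nonneg Real.pi_pos.le, div_le_iff₀ Real.pi_pos]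
    have := norm_sin_le_exp_abs_im (π * z)
    rw [Complex.im_ofReal_mul, abs_mul, abs_of_pos Real.pi_pos] at this
    nlinarith [Real.pi_gt_three, Real.exp_pos (π * |z.im|)]
  rw [h4, norm_mul]
  gcongr

/-- Mellin transforms are bounded on vertical strips of absolute convergence. -/
lemma exists_norm_mellin_le {f : ℝ → ℂ} {a b : ℝ} (ha : MellinConvergent f a)
    (hb : MellinConvergent f b) :
    ∃ C : ℝ, 0 < C ∧ ∀ s : ℂ, a ≤ s.re → s.re ≤ b → ‖mellin f s‖ ≤ C := by
  have hi := ha.norm.add hb.norm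
  refine ⟨max (∫ t in Set.Ioi (0 : ℝ), (‖(t : ℂ) ^ ((a : ℂ) - 1) • f t‖ +
    ‖(t : ℂ) ^ ((b : ℂ) - 1) • f t‖)) 1, by positivity, fun s h1 h2 => ?_⟩
  refine le_trans ?_ (le_max_left _ _)
  refine norm_integral_le_of_norm_le hi ?_
  refine (ae_restrict_iff' measurableSet_Ioi).2 (Eventually.of_forall fun t ht => ?_)
  rw [Set.mem_Ioi] at ht
  simp only [norm_smul, Complex.norm_cpow_eq_rpow_re_of_pos ht, sub_re, one_re, ofReal_re]
  rw [← add_mul]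
  gcongr
  rcases le_total 1 t with h | h
  · exact (Real.rpow_le_rpow_of_exponent_le h (by linarith)).trans
      (le_add_of_nonneg_left (by positivity))
  · exact (Real.rpow_le_rpow_of_exponent_ge ht h (by linarith)).trans
      (le_add_of_nonneg_right (by positivity))

lemma IsStrongFEPair.exists_norm_Λ_le {P : WeakFEPair ℂ} (hP : IsStrongFEPair P) (a b : ℝ) :
    ∃ C : ℝ, 0 < C ∧ ∀ s : ℂ, a ≤ s.re → s.re ≤ b → ‖P.Λ s‖ ≤ C := by
  rw [hP.Λ_eq]
  exact exists_norm_mellin_le (hP.hasMellin _).1 (hP.hasMellin _).1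

lemma WeakFEPair.exists_norm_Λ₀_le (P : WeakFEPair ℂ) (a b : ℝ) :
    ∃ C : ℝ, 0 < C ∧ ∀ s : ℂ, a ≤ s.re → s.re ≤ b → ‖P.Λ₀ s‖ ≤ C :=
  exists_norm_mellin_le (P.isStrongFEPair_toStrongFEPair.hasMellin _).1
    (P.isStrongFEPair_toStrongFEPair.hasMellin _).1

lemma exists_norm_inv_Gammaℝ_le {a b : ℝ} (hb : b < 2) :
    ∃ C : ℝ, 0 < C ∧ ∀ s : ℂ, a ≤ s.re → s.re ≤ b →
      ‖(Gammaℝ s)⁻¹‖ ≤ C * Real.exp (2 * |s.im|) := by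
  obtain ⟨C, hC, h⟩ := exists_norm_inv_Gamma_le (a := a / 2) (b := b / 2) (by linarith)
  refine ⟨π ^ (b / 2) * C, by positivity, fun s h1 h2 => ?_⟩
  have e1 : (s / 2).re = s.re / 2 := by simp
  have e2 : (s / 2).im = s.im / 2 := by simp
  have h3 := h (s / 2) (by rw [e1]; linarith) (by rw [e1]; linarith)
  rw [e2, abs_div, abs_two] at h3
  rw [Gammaℝ_def, mul_inv, norm_mul, ← cpow_neg, Complex.norm_cpow_eq_rpow_re_of_pos Real.pi_pos]
  have e3 : (-(-s / 2)).re = s.re / 2 := by rw [neg_div, neg_neg, e1]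
  rw [e3, mul_assoc]
  refine mul_le_mul (Real.rpow_le_rpow_of_exponent_le (by linarith [Real.pi_gt_three])
    (by linarith)) (h3.trans (mul_le_mul_of_nonneg_left (Real.exp_le_exp.2 ?_) hC.le))
    (norm_nonneg _) (by positivity)
  nlinarith [Real.pi_lt_four, abs_nonneg s.im]

lemma exists_norm_hurwitzZetaEven_le (x : UnitAddCircle) {a b : ℝ} (hb : b < 2) :
    ∃ C : ℝ, 0 < C ∧ ∀ s : ℂ, a ≤ s.re → s.re ≤ b → 1 ≤ |s.im| →
      ‖hurwitzZetaEven x s‖ ≤ C * Real.exp (2 * |s.im|) := by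
  obtain ⟨C₁, hC₁, h1⟩ := exists_norm_inv_Gammaℝ_le (a := a) hb
  obtain ⟨C₂, hC₂, h2⟩ := (hurwitzEvenFEPair x).exists_norm_Λ₀_le (a / 2) (b / 2)
  refine ⟨(C₂ + 2) * C₁, by positivity, fun s hs1 hs2 ht => ?_⟩
  have hs0 : 1 ≤ ‖s‖ := ht.trans (Complex.abs_im_le_norm s)
  have hs1' : 1 ≤ ‖1 - s‖ := by
    have := Complex.abs_im_le_norm (1 - s)
    simp at this
    linarith
  have hne : s ≠ 0 := by
    intro h; rw [h] at hs0; simp at hs0; linarith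
  have h3 : ‖completedHurwitzZetaEven x s‖ ≤ C₂ + 2 := by
    rw [completedHurwitzZetaEven_eq]
    have e0 : ‖completedHurwitzZetaEven₀ x s‖ ≤ C₂ := by
      rw [completedHurwitzZetaEven₀, norm_div, Complex.norm_ofNat]
      have := h2 (s / 2) (by simp; linarith) (by simp; linarith)
      linarith [norm_nonneg ((hurwitzEvenFEPair x).Λ₀ (s / 2))]
    have e1 : ‖(if x = 0 then 1 else 0 : ℂ) / s‖ ≤ 1 := by
      rw [norm_div]
      refine div_le_one_of_le₀ (le_trans ?_ hs0) (norm_nonneg _)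
      split_ifs <;> simp
    have e2 : ‖1 / (1 - s)‖ ≤ 1 := by
      rw [norm_div, norm_one]
      exact div_le_one_of_le₀ hs1' (norm_nonneg _)
    refine (norm_sub_le _ _).trans ?_
    have := norm_sub_le (completedHurwitzZetaEven₀ x s) ((if x = 0 then 1 else 0 : ℂ) / s)
    linarith
  rw [hurwitzZetaEven_def_of_ne_or_ne (Or.inr hne), div_eq_mul_inv, norm_mul, mul_assoc]
  gcongr
  exact h1 s hs1 hs2

lemma exists_norm_hurwitzZetaOdd_le (x : UnitAddCircle) {a b : ℝ} (hb : b < 3) :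
    ∃ C : ℝ, 0 < C ∧ ∀ s : ℂ, a ≤ s.re → s.re ≤ b → 1 ≤ |s.im| →
      ‖hurwitzZetaOdd x s‖ ≤ C * Real.exp (2 * |s.im|) := by
  obtain ⟨C₁, hC₁, h1⟩ := exists_norm_inv_Gammaℝ_le (a := a - 1) (b := b - 1) (by linarith)
  obtain ⟨C₂, hC₂, h2⟩ := (isStrong_hurwitzOddFEPair x).exists_norm_Λ_le ((a + 1) / 2) ((b + 1) / 2)
  refine ⟨C₂ * (2 * π * C₁), by positivity, fun s hs1 hs2 ht => ?_⟩
  have hs1' : 1 ≤ ‖s - 1‖ := by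
    have := Complex.abs_im_le_norm (s - 1)
    simp at this
    linarith
  have hne : s - 1 ≠ 0 := by
    intro h; rw [h] at hs1'; simp at hs1'; linarith
  have e0 : ‖completedHurwitzZetaOdd x s‖ ≤ C₂ := by
    rw [completedHurwitzZetaOdd, norm_div, Complex.norm_ofNat]
    have := h2 ((s + 1) / 2) (by simp; linarith) (by simp; linarith)
    linarith [norm_nonneg ((hurwitzOddFEPair x).Λ ((s + 1) / 2))]
  have e1 : (Gammaℝ (s + 1))⁻¹ = (Gammaℝ (s - 1))⁻¹ * (2 * π / (s - 1)) := by
    have : s + 1 = s - 1 + 2 := by ring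
    rw [this, Gammaℝ_add_two hne]
    field_simp
  have e2 : ‖2 * π / (s - 1)‖ ≤ 2 * π := by
    rw [norm_div, norm_mul, Complex.norm_of_nonneg Real.pi_pos.le, Complex.norm_ofNat]
    exact div_le_self (by positivity) hs1'
  have e3 := h1 (s - 1) (by simp; linarith) (by simp; linarith)
  simp only [sub_im, one_im, sub_zero] at e3
  rw [hurwitzZetaOdd, div_eq_mul_inv, norm_mul, e1, norm_mul]
  calc _ ≤ C₂ * (C₁ * Real.exp (2 * |s.im|) * (2 * π)) := by gcongr
    _ = _ := by ring

lemma exists_norm_LFunction_strip_le {N : ℕ} [NeZero N] (χ : DirichletCharacter ℂ N) (a : ℝ)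
    {b : ℝ} (hb : b < 2) : ∃ C : ℝ, 0 < C ∧ ∀ s : ℂ, a ≤ s.re → s.re ≤ b → 1 ≤ |s.im| →
      ‖χ.LFunction s‖ ≤ C * Real.exp (2 * |s.im|) := by
  choose C₁ hC₁ h1 using fun x => exists_norm_hurwitzZetaEven_le x (a := a) hb
  choose C₂ hC₂ h2 using fun x => exists_norm_hurwitzZetaOdd_le x (a := a) (b := b) (by linarith)
  refine ⟨(N : ℝ) ^ (-a) * ∑ j : ZMod N, (C₁ (ZMod.toAddCircle j) + C₂ (ZMod.toAddCircle j)), ?_,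
    fun s hs1 hs2 ht => ?_⟩
  · have hN : (0 : ℝ) < N := by exact_mod_cast Nat.pos_of_neZero N
    exact mul_pos (Real.rpow_pos_of_pos hN _)
      (Finset.sum_pos (fun j _ => add_pos (hC₁ _) (hC₂ _)) ⟨0, Finset.mem_univ _⟩)
  have hN : (1 : ℝ) ≤ N := by exact_mod_cast Nat.pos_of_neZero N
  rw [DirichletCharacter.LFunction, ZMod.LFunction, norm_mul, ← ofReal_natCast,
    Complex.norm_cpow_eq_rpow_re_of_pos (by linarith), mul_assoc, Finset.sum_mul]
  gcongr
  · simpa using hs1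
  refine (norm_sum_le _ _).trans (Finset.sum_le_sum fun j _ => ?_)
  rw [norm_mul, hurwitzZeta]
  calc _ ≤ 1 * ‖hurwitzZetaEven (ZMod.toAddCircle j) s + hurwitzZetaOdd (ZMod.toAddCircle j) s‖ := by
        gcongr
        exact χ.norm_le_one j
    _ ≤ _ := by
      rw [one_mul, add_mul]
      exact (norm_add_le _ _).trans (add_le_add (h1 _ s hs1 hs2 ht) (h2 _ s hs1 hs2 ht))

lemma exists_norm_regularizedLFunction_le {N : ℕ} [NeZero N] (χ : DirichletCharacter ℂ N) :
    ∃ C : ℝ, 0 < C ∧ ∀ s : ℂ, -(1 / 2) ≤ s.re → s.re ≤ 3 / 2 →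
      ‖regularizedLFunction χ s‖ ≤ C * Real.exp (3 * |s.im|) := by
  obtain ⟨C₁, hC₁, h1⟩ := exists_norm_LFunction_strip_le χ (-(1 / 2)) (b := 3 / 2) (by norm_num)
  obtain ⟨C₂, h2⟩ := (isCompact_Icc.reProdIm isCompact_Icc :
    IsCompact (Set.Icc (-(1 / 2) : ℝ) (3 / 2) ×ℂ Set.Icc (-1 : ℝ) 1)).exists_bound_of_continuousOn
    (differentiable_regularizedLFunction χ).continuous.continuousOn
  refine ⟨3 * C₁ + |C₂|, by positivity, fun s hs1 hs2 => ?_⟩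
  rcases le_total 1 |s.im| with ht | ht
  · have hne : s ≠ 1 := by
      rintro rfl
      simp at ht
      linarith
    rw [regularizedLFunction_of_ne_one χ hne, norm_mul]
    have h3 : ‖s - 1‖ ≤ 3 * Real.exp |s.im| := by
      refine (Complex.norm_le_abs_re_add_abs_im _).trans ?_
      simp only [sub_re, one_re, sub_im, one_im, sub_zero]
      have := Real.add_one_le_exp |s.im|
      have : |s.re - 1| ≤ 3 / 2 := abs_le.2 ⟨by linarith, by linarith⟩
      linarith
    calc _ ≤ 3 * Real.exp |s.im| * (C₁ * Real.exp (2 * |s.im|)) := by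
          gcongr
          exact h1 s hs1 hs2 ht
      _ = 3 * C₁ * Real.exp (3 * |s.im|) := by
        rw [show 3 * |s.im| = |s.im| + 2 * |s.im| by ring, Real.exp_add]; ring
      _ ≤ _ := by
        gcongr
        linarith [abs_nonneg C₂]
  · have := h2 s ⟨⟨hs1, hs2⟩, abs_le.1 ht⟩
    calc _ ≤ (3 * C₁ + |C₂|) * 1 := by linarith [le_abs_self C₂]
      _ ≤ _ := by
        gcongr
        exact Real.one_le_exp (by positivity)

lemma norm_Gamma_one_half_add_mul_I_le (t : ℝ) :
    ‖Complex.Gamma (1 / 2 + t * I)‖ ≤ 3 * Real.exp (-(π / 2 * |t|)) := by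
  have h1 := Complex.Gamma_mul_Gamma_one_sub (1 / 2 + t * I)
  have e1 : (1 : ℂ) - (1 / 2 + t * I) = starRingEnd ℂ (1 / 2 + t * I) := by
    rw [map_add, map_mul, conj_ofReal, conj_I, map_div₀, map_one, map_ofNat]
    ring
  have e2 : Complex.sin (π * (1 / 2 + t * I)) = ((Real.cosh (π * t) : ℝ) : ℂ) := by
    rw [show (π : ℂ) * (1 / 2 + t * I) = (π * t) * I + π / 2 by ring, Complex.sin_add_pi_div_two,
      Complex.cos_mul_I]
    push_cast
    rfl
  rw [e1, Complex.Gamma_conj, Complex.mul_conj, e2, Complex.normSq_eq_norm_sq, ← ofReal_div,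
    ofReal_inj] at h1
  have h2 : Real.exp (π * |t|) / 2 ≤ Real.cosh (π * t) := by
    rw [← Real.cosh_abs, abs_mul, abs_of_pos Real.pi_pos, Real.cosh_eq]
    have := Real.exp_pos (-(π * |t|))
    linarith
  refine le_of_sq_le_sq ?_ (by positivity)
  rw [h1, mul_pow, ← Real.exp_nat_mul, div_le_iff₀ (Real.cosh_pos _)]
  have e3 : Real.exp (((2 : ℕ) : ℝ) * -(π / 2 * |t|)) * Real.exp (π * |t|) = 1 := by
    rw [← Real.exp_add, Real.exp_eq_one_iff]
    push_cast
    ring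
  calc π ≤ 9 / 2 * 1 := by linarith [Real.pi_lt_four]
    _ = 3 ^ 2 * Real.exp (((2 : ℕ) : ℝ) * -(π / 2 * |t|)) * (Real.exp (π * |t|) / 2) := by
      rw [← e3]; ring
    _ ≤ _ := by gcongr

/-- The factor `Y` in the functional equation `(s - 1)² L(s, χ) = Y(s) L(1 - s, χ⁻¹)` of a
primitive Dirichlet character. -/
noncomputable def functionalEquationFactor {N : ℕ} [NeZero N] (χ : DirichletCharacter ℂ N) (s : ℂ) : ℂ :=
  -(s - 1) * Complex.Gamma (2 - s) * (N ^ (-s) * (2 * π : ℝ) ^ (s - 1) *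
    (gaussSum χ ZMod.stdAddChar * (χ⁻¹ (-1) * cexp (π * I * (1 - s) / 2) +
      cexp (-π * I * (1 - s) / 2))))

lemma differentiableAt_functionalEquationFactor {N : ℕ} [NeZero N] (χ : DirichletCharacter ℂ N)
    {s : ℂ} (hs : s.re < 2) : DifferentiableAt ℂ (functionalEquationFactor χ) s := by
  have h1 : DifferentiableAt ℂ Complex.Gamma (2 - s) := by
    refine Complex.differentiableAt_Gamma _ fun m h => ?_
    have := congrArg Complex.re h
    simp at this
    have : (0 : ℝ) ≤ m := m.cast_nonneg
    linarith
  have h2 : DifferentiableAt ℂ (fun s => Complex.Gamma (2 - s)) s :=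
    h1.comp s (by fun_prop)
  have h3 : DifferentiableAt ℂ (fun s : ℂ => (N : ℂ) ^ (-s)) s :=
    DifferentiableAt.const_cpow (by fun_prop) (Or.inl (by exact_mod_cast NeZero.ne N))
  have h4 : DifferentiableAt ℂ (fun s : ℂ => ((2 * π : ℝ) : ℂ) ^ (s - 1)) s :=
    DifferentiableAt.const_cpow (by fun_prop) (Or.inl (by exact_mod_cast (by positivity)))
  unfold functionalEquationFactor
  fun_prop

lemma DirichletCharacter.IsPrimitive.sub_one_sq_mul_LFunction {N : ℕ} [NeZero N]
    {χ : DirichletCharacter ℂ N} (hχ : χ.IsPrimitive) {s : ℂ} (hs : s.re < 0) :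
    (s - 1) ^ 2 * χ.LFunction s = functionalEquationFactor χ s * χ⁻¹.LFunction (1 - s) := by
  have h1 := ZMod.LFunction_one_sub χ (s := 1 - s) (fun n h => by
    have := congrArg Complex.re h
    simp at this
    have : (0 : ℝ) ≤ n := n.cast_nonneg
    linarith) (Or.inr fun h => by
    have := congrArg Complex.re h
    simp at this
    linarith)
  have hL (c : ℂ) : ZMod.LFunction (fun x => χ⁻¹ x * c) (1 - s) = c * χ⁻¹.LFunction (1 - s) := by
    rw [DirichletCharacter.LFunction, ZMod.LFunction, ZMod.LFunction, mul_left_comm,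
      Finset.mul_sum _ _ c]
    congr 1
    exact Finset.sum_congr rfl fun j _ => by ring
  have e1 : ZMod.dft (⇑χ) = fun k => χ⁻¹ k * (χ⁻¹ (-1) * gaussSum χ ZMod.stdAddChar) := by
    funext k
    rw [hχ.fourierTransform_eq_inv_mul_gaussSum, neg_eq_neg_one_mul, map_mul]
    ring
  have e2 : ZMod.dft (fun x => χ (-x)) = fun k => χ⁻¹ k * gaussSum χ ZMod.stdAddChar := by
    rw [ZMod.dft_comp_neg]
    funext k
    rw [hχ.fourierTransform_eq_inv_mul_gaussSum, neg_neg]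
  have hG : Complex.Gamma (2 - s) = (1 - s) * Complex.Gamma (1 - s) := by
    rw [← Complex.Gamma_add_one]
    · congr 1; ring
    · intro h
      have := congrArg Complex.re h
      simp at this
      linarith
  rw [sub_sub_cancel, e1, e2, hL, hL] at h1
  rw [DirichletCharacter.LFunction, h1, functionalEquationFactor, hG]
  have e3 : (1 : ℂ) - s - 1 = -s := by ring
  have e4 : -((1 : ℂ) - s) = s - 1 := by ring
  rw [e3, e4]
  push_cast
  ring

lemma exists_norm_functionalEquationFactor_le {N : ℕ} [NeZero N] (χ : DirichletCharacter ℂ N) :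
    ∃ C : ℝ, 0 < C ∧ ∀ s : ℂ, -(1 / 2) ≤ s.re → s.re ≤ 3 / 2 →
      ‖functionalEquationFactor χ s‖ ≤
        C * ((1 + |s.im|) * ‖Complex.Gamma (2 - s)‖ * Real.exp (π / 2 * |s.im|)) := by
  have hN : (1 : ℝ) ≤ N := by exact_mod_cast Nat.pos_of_neZero N
  set g := ‖gaussSum χ ZMod.stdAddChar‖ with hg
  refine ⟨2 * ((N : ℝ) ^ (1 / 2 : ℝ) * (2 * π) ^ (1 / 2 : ℝ) * ((g + 1) * 2)), by positivity,
    fun s h1 h2 => ?_⟩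
  have e1 : ‖(N : ℂ) ^ (-s)‖ ≤ (N : ℝ) ^ (1 / 2 : ℝ) := by
    rw [← ofReal_natCast, Complex.norm_cpow_eq_rpow_re_of_pos (by linarith)]
    exact Real.rpow_le_rpow_of_exponent_le hN (by simp only [neg_re]; linarith)
  have e2 : ‖((2 * π : ℝ) : ℂ) ^ (s - 1)‖ ≤ (2 * π) ^ (1 / 2 : ℝ) := by
    rw [Complex.norm_cpow_eq_rpow_re_of_pos (by positivity)]
    exact Real.rpow_le_rpow_of_exponent_le (by linarith [Real.pi_gt_three])
      (by simp only [sub_re, one_re]; linarith)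
  have e3 : ‖cexp (π * I * (1 - s) / 2)‖ ≤ Real.exp (π / 2 * |s.im|) := by
    rw [Complex.norm_exp]
    refine Real.exp_le_exp.2 ?_
    have : (π * I * (1 - s) / 2).re = π / 2 * s.im := by
      simp; ring
    rw [this]
    exact mul_le_mul_of_nonneg_left (le_abs_self _) (by positivity)
  have e4 : ‖cexp (-π * I * (1 - s) / 2)‖ ≤ Real.exp (π / 2 * |s.im|) := by
    rw [Complex.norm_exp]
    refine Real.exp_le_exp.2 ?_
    have : (-π * I * (1 - s) / 2).re = π / 2 * (-s.im) := by
      simp; ring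
    rw [this]
    exact mul_le_mul_of_nonneg_left (neg_le_abs _) (by positivity)
  have e5 : ‖gaussSum χ ZMod.stdAddChar * (χ⁻¹ (-1) * cexp (π * I * (1 - s) / 2) +
      cexp (-π * I * (1 - s) / 2))‖ ≤ (g + 1) * (2 * Real.exp (π / 2 * |s.im|)) := by
    rw [norm_mul]
    gcongr
    · linarith
    refine (norm_add_le _ _).trans ?_
    rw [norm_mul]
    have := mul_le_mul (χ⁻¹.norm_le_one (-1)) e3 (norm_nonneg _) zero_le_one
    linarith
  have e6 : ‖-(s - 1)‖ ≤ 2 * (1 + |s.im|) := by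
    rw [norm_neg]
    refine (Complex.norm_le_abs_re_add_abs_im _).trans ?_
    simp only [sub_re, one_re, sub_im, one_im, sub_zero]
    have : |s.re - 1| ≤ 3 / 2 := abs_le.2 ⟨by linarith, by linarith⟩
    linarith [abs_nonneg s.im]
  rw [functionalEquationFactor, norm_mul, norm_mul, norm_mul, norm_mul]
  calc _ ≤ 2 * (1 + |s.im|) * ‖Complex.Gamma (2 - s)‖ * ((N : ℝ) ^ (1 / 2 : ℝ) *
      (2 * π) ^ (1 / 2 : ℝ) * ((g + 1) * (2 * Real.exp (π / 2 * |s.im|)))) := by gcongr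
    _ = _ := by ring

lemma exists_norm_functionalEquationFactor_le_exp {N : ℕ} [NeZero N]
    (χ : DirichletCharacter ℂ N) :
    ∃ C : ℝ, 0 < C ∧ ∀ s : ℂ, -(1 / 2) ≤ s.re → s.re ≤ 3 / 2 →
      ‖functionalEquationFactor χ s‖ ≤ C * Real.exp (3 * |s.im|) := by
  obtain ⟨C₁, hC₁, h1⟩ := exists_norm_functionalEquationFactor_le χ
  obtain ⟨C₂, hC₂, h2⟩ := exists_norm_Gamma_le (a := 1 / 2) (by norm_num) (5 / 2)
  refine ⟨C₁ * C₂, by positivity, fun s hs1 hs2 => (h1 s hs1 hs2).trans ?_⟩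
  have h3 := h2 (2 - s) (by simp; linarith) (by simp; linarith)
  have h4 : 1 + |s.im| ≤ Real.exp |s.im| := by linarith [Real.add_one_le_exp |s.im|]
  have h5 : Real.exp (π / 2 * |s.im|) ≤ Real.exp (2 * |s.im|) :=
    Real.exp_le_exp.2 (by nlinarith [Real.pi_lt_four, abs_nonneg s.im])
  calc _ ≤ C₁ * (Real.exp |s.im| * C₂ * Real.exp (2 * |s.im|)) := by gcongr
    _ = _ := by
      rw [show 3 * |s.im| = |s.im| + 2 * |s.im| by ring, Real.exp_add]
      ring

lemma norm_Gamma_mul_exp_le {k : ℕ} {s : ℂ} (t : ℝ) (hs : s = 1 / 2 + k + t * I) :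
    ‖Complex.Gamma s‖ * Real.exp (π / 2 * |t|) ≤ 3 * ((k + 1) * (1 + |t|)) ^ k := by
  suffices h : ∀ j : ℕ, j ≤ k → ‖Complex.Gamma (1 / 2 + j + t * I)‖ * Real.exp (π / 2 * |t|) ≤
      3 * ((k + 1) * (1 + |t|)) ^ j by
    rw [hs]; exact h k le_rfl
  intro j hj
  induction j with
  | zero =>
    have := norm_Gamma_one_half_add_mul_I_le t
    have e : Real.exp (-(π / 2 * |t|)) * Real.exp (π / 2 * |t|) = 1 := by
      rw [← Real.exp_add]; simp
    simp only [Nat.cast_zero, add_zero, pow_zero, mul_one]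
    calc _ ≤ 3 * Real.exp (-(π / 2 * |t|)) * Real.exp (π / 2 * |t|) := by gcongr
      _ = 3 := by rw [mul_assoc, e, mul_one]
  | succ j ih =>
    have e1 : (1 / 2 + ((j + 1 : ℕ) : ℂ) + t * I) = (1 / 2 + j + t * I) + 1 := by
      push_cast; ring
    have hne : (1 / 2 + j + t * I : ℂ) ≠ 0 := by
      intro h
      have := congrArg Complex.re h
      simp at this
      have : (0 : ℝ) ≤ j := j.cast_nonneg
      linarith
    have e2 : ‖(1 / 2 + j + t * I : ℂ)‖ ≤ (k + 1) * (1 + |t|) := by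
      have hre : (1 / 2 + j + t * I : ℂ).re = 1 / 2 + j := by simp
      have him : (1 / 2 + j + t * I : ℂ).im = t := by simp
      refine (Complex.norm_le_abs_re_add_abs_im _).trans ?_
      rw [hre, him, abs_of_nonneg (by positivity)]
      have : (j : ℝ) + 1 ≤ k := by exact_mod_cast hj
      nlinarith [abs_nonneg t, (k.cast_nonneg : (0 : ℝ) ≤ k)]
    rw [e1, Complex.Gamma_add_one _ hne, norm_mul, pow_succ]
    have := ih (by omega)
    calc _ = ‖(1 / 2 + j + t * I : ℂ)‖ * (‖Complex.Gamma (1 / 2 + j + t * I)‖ *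
          Real.exp (π / 2 * |t|)) := by ring
      _ ≤ (k + 1) * (1 + |t|) * (3 * ((k + 1) * (1 + |t|)) ^ j) := by gcongr
      _ = _ := by ring

lemma exists_norm_functionalEquationFactor_line_le {N : ℕ} [NeZero N]
    (χ : DirichletCharacter ℂ N) {k : ℕ} (hk : k ≤ 2) :
    ∃ C : ℝ, 0 < C ∧ ∀ t : ℝ,
      ‖functionalEquationFactor χ (3 / 2 - k + t * I)‖ ≤ C * (1 + |t|) ^ (k + 1) := by
  obtain ⟨C₁, hC₁, h1⟩ := exists_norm_functionalEquationFactor_le χ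
  refine ⟨C₁ * (3 * (k + 1) ^ k), by positivity, fun t => ?_⟩
  have hre : (3 / 2 - k + t * I : ℂ).re = 3 / 2 - k := by simp
  have him : (3 / 2 - k + t * I : ℂ).im = t := by simp
  have hk' : (k : ℝ) ≤ 2 := by exact_mod_cast hk
  have h2 := h1 (3 / 2 - k + t * I) (by rw [hre]; linarith)
    (by rw [hre]; linarith [(k.cast_nonneg : (0 : ℝ) ≤ k)])
  have h3 := norm_Gamma_mul_exp_le (k := k) (s := 2 - (3 / 2 - k + t * I)) (-t)
    (by push_cast; ring)
  rw [abs_neg] at h3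
  rw [him] at h2
  refine h2.trans ?_
  calc _ = C₁ * ((1 + |t|) * (‖Complex.Gamma (2 - (3 / 2 - k + t * I))‖ *
        Real.exp (π / 2 * |t|))) := by ring
    _ ≤ C₁ * ((1 + |t|) * (3 * ((k + 1) * (1 + |t|)) ^ k)) := by gcongr
    _ = _ := by rw [mul_pow]; ring

lemma one_add_abs_pow_mul_exp_le {T : ℝ} (hT : 1 ≤ T) (k : ℕ) (t : ℝ) :
    ((1 + |t|) ^ k * Real.exp (-(1 / T ^ 2) * t ^ 2)) ^ 2 ≤
      2 ^ k * k.factorial * Real.exp 1 * T ^ (2 * k) * Real.exp (-(1 / T ^ 2) * t ^ 2) := by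
  have hT0 : 0 < T := by linarith
  set u := |t| / T with hu
  have hu0 : 0 ≤ u := by positivity
  have e1 : 1 + |t| ≤ T * (1 + u) := by
    rw [mul_add, hu, mul_div_cancel₀ _ hT0.ne']
    linarith
  have e2 : -(1 / T ^ 2) * t ^ 2 = -u ^ 2 := by
    rw [hu, div_pow, sq_abs]; ring
  have e3 : (1 + u ^ 2) ^ k ≤ k.factorial * Real.exp (1 + u ^ 2) := by
    have := Real.pow_div_factorial_le_exp (1 + u ^ 2) (by positivity) k
    rwa [div_le_iff₀ (by positivity), mul_comm] at this
  have e4 : (1 + u) ^ 2 ≤ 2 * (1 + u ^ 2) := by nlinarith [sq_nonneg (1 - u)]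
  have e5 : ((1 + |t|) ^ k) ^ 2 ≤ T ^ (2 * k) * (2 ^ k * (k.factorial * Real.exp (1 + u ^ 2))) := by
    calc ((1 + |t|) ^ k) ^ 2 = ((1 + |t|) ^ 2) ^ k := by rw [← pow_mul, ← pow_mul, mul_comm]
      _ ≤ ((T * (1 + u)) ^ 2) ^ k := by gcongr
      _ = T ^ (2 * k) * ((1 + u) ^ 2) ^ k := by rw [mul_pow, mul_pow, pow_mul]
      _ ≤ T ^ (2 * k) * (2 * (1 + u ^ 2)) ^ k := by gcongr
      _ ≤ _ := by rw [mul_pow]; gcongr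
  rw [e2, mul_pow]
  calc _ ≤ T ^ (2 * k) * (2 ^ k * (k.factorial * Real.exp (1 + u ^ 2))) *
        Real.exp (-u ^ 2) ^ 2 := by gcongr
    _ = 2 ^ k * k.factorial * (Real.exp (1 + u ^ 2) * Real.exp (-u ^ 2)) * T ^ (2 * k) *
        Real.exp (-u ^ 2) := by ring
    _ = _ := by rw [← Real.exp_add, add_neg_cancel_right]

lemma integrable_norm_sq_mul_exp {T b : ℝ} (hT : 1 ≤ T) {D : ℝ → ℂ} (hD : Continuous D)
    (hb : ∀ t, ‖D t‖ ≤ b) :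
    Integrable fun t : ℝ => ‖D t‖ ^ 2 * Real.exp (-(1 / T ^ 2) * t ^ 2) := by
  refine ((integrable_exp_neg_mul_sq (b := 1 / T ^ 2) (by positivity)).const_mul (b ^ 2)).mono'
    (by fun_prop) (Eventually.of_forall fun t => ?_)
  rw [Real.norm_of_nonneg (by positivity)]
  gcongr
  exact hb t

/-- Two-term mean square bound with polynomially growing Gaussian weights. -/
lemma integral_norm_sq_le_of_two_terms {T C B₁ B₂ b₁ b₂ : ℝ} (hT : 1 ≤ T)
    (k l : ℕ) {G D₁ D₂ : ℝ → ℂ} (hG0 : Continuous G)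
    (hG : ∀ t, ‖G t‖ ≤ C * ((1 + |t|) ^ k * Real.exp (-(1 / T ^ 2) * t ^ 2)) * ‖D₁ t‖ +
      C * ((1 + |t|) ^ l * Real.exp (-(1 / T ^ 2) * t ^ 2)) * ‖D₂ t‖)
    (hD₁ : Continuous D₁) (hD₂ : Continuous D₂) (hb₁ : ∀ t, ‖D₁ t‖ ≤ b₁) (hb₂ : ∀ t, ‖D₂ t‖ ≤ b₂)
    (hB₁ : ∫ t : ℝ, ‖D₁ t‖ ^ 2 * Real.exp (-(1 / T ^ 2) * t ^ 2) ≤ B₁)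
    (hB₂ : ∫ t : ℝ, ‖D₂ t‖ ^ 2 * Real.exp (-(1 / T ^ 2) * t ^ 2) ≤ B₂) :
    Integrable (fun t => ‖G t‖ ^ 2) ∧ ∫ t : ℝ, ‖G t‖ ^ 2 ≤
      2 * C ^ 2 * (2 ^ k * k.factorial * Real.exp 1) * T ^ (2 * k) * B₁ +
      2 * C ^ 2 * (2 ^ l * l.factorial * Real.exp 1) * T ^ (2 * l) * B₂ := by
  have i1 := (integrable_norm_sq_mul_exp hT hD₁ hb₁).const_mul
    (2 * C ^ 2 * (2 ^ k * k.factorial * Real.exp 1) * T ^ (2 * k))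
  have i2 := (integrable_norm_sq_mul_exp hT hD₂ hb₂).const_mul
    (2 * C ^ 2 * (2 ^ l * l.factorial * Real.exp 1) * T ^ (2 * l))
  have hle (t : ℝ) : ‖G t‖ ^ 2 ≤
      2 * C ^ 2 * (2 ^ k * k.factorial * Real.exp 1) * T ^ (2 * k) *
        (‖D₁ t‖ ^ 2 * Real.exp (-(1 / T ^ 2) * t ^ 2)) +
      2 * C ^ 2 * (2 ^ l * l.factorial * Real.exp 1) * T ^ (2 * l) *
        (‖D₂ t‖ ^ 2 * Real.exp (-(1 / T ^ 2) * t ^ 2)) := by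
    have h1 := one_add_abs_pow_mul_exp_le hT k t
    have h2 := one_add_abs_pow_mul_exp_le hT l t
    refine (pow_le_pow_left₀ (norm_nonneg _) (hG t) 2).trans ?_
    set X := (1 + |t|) ^ k * Real.exp (-(1 / T ^ 2) * t ^ 2)
    set Y := (1 + |t|) ^ l * Real.exp (-(1 / T ^ 2) * t ^ 2)
    calc _ ≤ 2 * C ^ 2 * ‖D₁ t‖ ^ 2 * X ^ 2 + 2 * C ^ 2 * ‖D₂ t‖ ^ 2 * Y ^ 2 := by
          nlinarith [sq_nonneg (C * X * ‖D₁ t‖ - C * Y * ‖D₂ t‖)]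
      _ ≤ 2 * C ^ 2 * ‖D₁ t‖ ^ 2 * (2 ^ k * k.factorial * Real.exp 1 * T ^ (2 * k) *
            Real.exp (-(1 / T ^ 2) * t ^ 2)) + 2 * C ^ 2 * ‖D₂ t‖ ^ 2 *
            (2 ^ l * l.factorial * Real.exp 1 * T ^ (2 * l) *
            Real.exp (-(1 / T ^ 2) * t ^ 2)) := by gcongr
      _ = _ := by ring
  refine ⟨(i1.add i2).mono' (by fun_prop) (Eventually.of_forall fun t => ?_), ?_⟩
  · rw [Real.norm_of_nonneg (by positivity)]
    exact hle t
  · refine (integral_mono_of_nonneg (Eventually.of_forall fun t => by positivity) (i1.add i2)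
      (Eventually.of_forall hle)).trans ?_
    simp only [Pi.add_apply]
    rw [integral_add i1 i2, integral_const_mul, integral_const_mul]
    gcongr

lemma continuous_tsum_mul_cexp {c : ℕ → ℂ} (hc : Summable fun n => ‖c n‖) :
    Continuous fun t : ℝ => ∑' n, c n * cexp (-(I * t * Real.log n)) := by
  refine continuous_tsum (fun n => by fun_prop) hc fun n t => ?_
  rw [norm_mul, show -(I * t * Real.log n) = ((-(t * Real.log n) : ℝ) : ℂ) * I by push_cast; ring,
    Complex.norm_exp_ofReal_mul_I, mul_one]

lemma norm_tsum_mul_cexp_le {c : ℕ → ℂ} (hc : Summable fun n => ‖c n‖) (t : ℝ) :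
    ‖∑' n, c n * cexp (-(I * t * Real.log n))‖ ≤ ∑' n, ‖c n‖ := by
  have (n : ℕ) : ‖c n * cexp (-(I * t * Real.log n))‖ = ‖c n‖ := by
    rw [norm_mul, show -(I * t * Real.log n) = ((-(t * Real.log n) : ℝ) : ℂ) * I by
      push_cast; ring, Complex.norm_exp_ofReal_mul_I, mul_one]
  refine (norm_tsum_le_tsum_norm (by simpa only [this])).trans_eq (by simp only [this])

lemma integral_norm_sq_tsum_le_of_le {T R : ℝ} (hT : 2 ≤ T) {c : ℕ → ℂ} {f : ℕ → ℝ}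
    (hc0 : c 0 = 0) (hc : Summable fun n => ‖c n‖) (hf : Summable f)
    (hcf : ∀ n : ℕ, (T + n) * ‖c n‖ ^ 2 ≤ R * f n) :
    ∫ t : ℝ, ‖∑' n, c n * cexp (-(I * t * Real.log n))‖ ^ 2 * Real.exp (-(1 / T ^ 2) * t ^ 2) ≤
      15 * (R * ∑' n, f n) := by
  have h2 : Summable fun n : ℕ => (T + n) * ‖c n‖ ^ 2 :=
    (hf.mul_left R).of_nonneg_of_le (fun n => by positivity) hcf
  refine (integral_norm_sq_tsum_le hT hc0 hc h2).trans ?_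
  rw [← tsum_mul_left (a := R)]
  exact mul_le_mul_of_nonneg_left (h2.tsum_le_tsum hcf (hf.mul_left R)) (by norm_num)

/-- The coefficients `a n * n ^ (-σ)` for `1 ≤ n ≤ N`. -/
noncomputable def headCoeff (a : ℕ → ℂ) (N : ℕ) (σ : ℝ) (n : ℕ) : ℂ :=
  if n ∈ Finset.Icc 1 N then a n * ((n : ℝ) ^ (-σ) : ℝ) else 0

/-- The coefficients `a n * n ^ (-σ)` for `n` outside `[1, N]`. -/
noncomputable def tailCoeff (a : ℕ → ℂ) (N : ℕ) (σ : ℝ) (n : ℕ) : ℂ :=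
  if n ∈ Finset.Icc 1 N then 0 else a n * ((n : ℝ) ^ (-σ) : ℝ)

/-- The Dirichlet series `∑ c n * n ^ (-it)`. -/
noncomputable def lineSeries (c : ℕ → ℂ) (t : ℝ) : ℂ :=
  ∑' n, c n * cexp (-(I * t * Real.log n))

lemma natCast_cpow_neg {n : ℕ} (hn : n ≠ 0) (σ t : ℝ) :
    (n : ℂ) ^ (-(σ + t * I)) = ((n : ℝ) ^ (-σ) : ℝ) * cexp (-(I * t * Real.log n)) := by
  have h0 : (0 : ℝ) < n := by exact_mod_cast Nat.pos_of_ne_zero hn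
  rw [Complex.cpow_def_of_ne_zero (by exact_mod_cast hn), Real.rpow_def_of_pos h0, ofReal_exp,
    ← Complex.exp_add, ← Complex.natCast_log]
  congr 1
  push_cast
  ring

lemma summable_norm_headCoeff (a : ℕ → ℂ) (N : ℕ) (σ : ℝ) :
    Summable fun n => ‖headCoeff a N σ n‖ :=
  summable_of_ne_finset_zero (s := Finset.Icc 1 N) fun n hn => by rw [headCoeff, if_neg hn]; simp

lemma sum_Icc_mul_cpow_eq (a : ℕ → ℂ) (N : ℕ) (σ t : ℝ) :
    ∑ n ∈ Finset.Icc 1 N, a n * (n : ℂ) ^ (-(σ + t * I)) = lineSeries (headCoeff a N σ) t := by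
  rw [lineSeries, tsum_eq_sum (s := Finset.Icc 1 N) fun n hn => by rw [headCoeff, if_neg hn]; simp]
  refine Finset.sum_congr rfl fun n hn => ?_
  rw [headCoeff, if_pos hn, natCast_cpow_neg (by have := (Finset.mem_Icc.1 hn).1; omega)]
  ring

lemma summable_norm_tailCoeff {a : ℕ → ℂ} (N : ℕ) {σ : ℝ}
    (ha : Summable fun n : ℕ => ‖a n‖ * (n : ℝ) ^ (-σ)) :
    Summable fun n => ‖tailCoeff a N σ n‖ := by
  refine ha.of_nonneg_of_le (fun n => norm_nonneg _) fun n => ?_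
  rw [tailCoeff]
  split_ifs
  · simp only [norm_zero]; positivity
  · rw [norm_mul, Complex.norm_of_nonneg (by positivity)]

lemma tsum_mul_cpow_eq {a : ℕ → ℂ} (ha0 : a 0 = 0) (N : ℕ) {σ : ℝ} (t : ℝ)
    (ha : Summable fun n : ℕ => ‖a n‖ * (n : ℝ) ^ (-σ)) :
    ∑' n : ℕ, a n * (n : ℂ) ^ (-(σ + t * I)) =
      ∑ n ∈ Finset.Icc 1 N, a n * (n : ℂ) ^ (-(σ + t * I)) + lineSeries (tailCoeff a N σ) t := by
  have hs {c : ℕ → ℂ} (hc : Summable fun n => ‖c n‖) :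
      Summable fun n => c n * cexp (-(I * t * Real.log n)) := by
    refine Summable.of_norm ?_
    convert hc using 2 with n
    rw [norm_mul, show -(I * t * Real.log n) = ((-(t * Real.log n) : ℝ) : ℂ) * I by
      push_cast; ring, Complex.norm_exp_ofReal_mul_I, mul_one]
  rw [sum_Icc_mul_cpow_eq, lineSeries, lineSeries,
    ← (hs (summable_norm_headCoeff a N σ)).tsum_add (hs (summable_norm_tailCoeff N ha))]
  refine tsum_congr fun n => ?_
  rcases eq_or_ne n 0 with rfl | hn
  · simp [headCoeff, tailCoeff, ha0]
  · rw [natCast_cpow_neg hn, headCoeff, tailCoeff]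
    split_ifs <;> ring

lemma continuous_lineSeries {c : ℕ → ℂ} (hc : Summable fun n => ‖c n‖) :
    Continuous (lineSeries c) := continuous_tsum_mul_cexp hc

lemma integral_norm_sq_lineSeries_neg (c : ℕ → ℂ) (T : ℝ) :
    ∫ t : ℝ, ‖lineSeries c (-t)‖ ^ 2 * Real.exp (-(1 / T ^ 2) * t ^ 2) =
      ∫ t : ℝ, ‖lineSeries c t‖ ^ 2 * Real.exp (-(1 / T ^ 2) * t ^ 2) := by
  rw [← integral_neg_eq_self (fun t : ℝ => ‖lineSeries c t‖ ^ 2 *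
    Real.exp (-(1 / T ^ 2) * t ^ 2))]
  simp only [neg_sq]

lemma integral_norm_sq_head_le {T : ℝ} (hT : 3 ≤ T) {a : ℕ → ℂ}
    (hf : Summable fun n : ℕ => ‖a n‖ ^ 2 * (n : ℝ) ^ (-(1 + 1 / Real.log T)))
    {σ R : ℝ} (hR : 0 ≤ R)
    (h : ∀ x : ℝ, 0 < x → x ≤ T → (T + x) * (x ^ (-σ)) ^ 2 ≤ R * x ^ (-(1 + 1 / Real.log T))) :
    ∫ t : ℝ, ‖lineSeries (headCoeff a ⌊T⌋₊ σ) t‖ ^ 2 * Real.exp (-(1 / T ^ 2) * t ^ 2) ≤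
      15 * (R * ∑' n : ℕ, ‖a n‖ ^ 2 * (n : ℝ) ^ (-(1 + 1 / Real.log T))) := by
  refine integral_norm_sq_tsum_le_of_le (by linarith) (by simp [headCoeff])
    (summable_norm_headCoeff a _ σ) hf fun n => ?_
  rw [headCoeff]
  split_ifs with hn
  · rw [Finset.mem_Icc, Nat.le_floor_iff (by linarith)] at hn
    have h0 : (0 : ℝ) < n := by exact_mod_cast hn.1
    rw [norm_mul, Complex.norm_of_nonneg (by positivity), mul_pow]
    calc _ = ‖a n‖ ^ 2 * ((T + n) * ((n : ℝ) ^ (-σ)) ^ 2) := by ring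
      _ ≤ ‖a n‖ ^ 2 * (R * (n : ℝ) ^ (-(1 + 1 / Real.log T))) :=
        mul_le_mul_of_nonneg_left (h n h0 hn.2) (by positivity)
      _ = _ := by ring
  · rw [norm_zero, zero_pow two_ne_zero, mul_zero]
    positivity

lemma integral_norm_sq_head_neg_half_le {T : ℝ} (hT : 3 ≤ T) {a : ℕ → ℂ}
    (hf : Summable fun n : ℕ => ‖a n‖ ^ 2 * (n : ℝ) ^ (-(1 + 1 / Real.log T))) :
    ∫ t : ℝ, ‖lineSeries (headCoeff a ⌊T⌋₊ (-(1 / 2))) t‖ ^ 2 * Real.exp (-(1 / T ^ 2) * t ^ 2) ≤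
      15 * (6 * T ^ 3 * ∑' n : ℕ, ‖a n‖ ^ 2 * (n : ℝ) ^ (-(1 + 1 / Real.log T))) := by
  refine integral_norm_sq_head_le hT hf (by positivity) fun x hx hxT => ?_
  rw [← Real.rpow_natCast, ← Real.rpow_mul hx.le]
  norm_num
  simpa using rankin_weight_le (by linarith) hx hxT

lemma integral_norm_sq_head_half_le {T : ℝ} (hT : 3 ≤ T) {a : ℕ → ℂ}
    (hf : Summable fun n : ℕ => ‖a n‖ ^ 2 * (n : ℝ) ^ (-(1 + 1 / Real.log T))) :
    ∫ t : ℝ, ‖lineSeries (headCoeff a ⌊T⌋₊ (1 / 2)) t‖ ^ 2 * Real.exp (-(1 / T ^ 2) * t ^ 2) ≤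
      15 * (6 * T * ∑' n : ℕ, ‖a n‖ ^ 2 * (n : ℝ) ^ (-(1 + 1 / Real.log T))) := by
  refine integral_norm_sq_head_le hT hf (by positivity) fun x hx hxT => ?_
  rw [← Real.rpow_natCast, ← Real.rpow_mul hx.le,
    show -(1 / 2 : ℝ) * (2 : ℕ) = -1 by norm_num, Real.rpow_neg_one]
  exact rankin_weight_inv_le (by linarith) hx hxT

lemma integral_norm_sq_tail_le {T : ℝ} (hT : 3 ≤ T) {a : ℕ → ℂ}
    (hf : Summable fun n : ℕ => ‖a n‖ ^ 2 * (n : ℝ) ^ (-(1 + 1 / Real.log T)))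
    (ha0 : a 0 = 0) (ha : Summable fun n : ℕ => ‖a n‖ * (n : ℝ) ^ (-(3 / 2 : ℝ))) :
    ∫ t : ℝ, ‖lineSeries (tailCoeff a ⌊T⌋₊ (3 / 2)) t‖ ^ 2 * Real.exp (-(1 / T ^ 2) * t ^ 2) ≤
      15 * (6 * T⁻¹ * ∑' n : ℕ, ‖a n‖ ^ 2 * (n : ℝ) ^ (-(1 + 1 / Real.log T))) := by
  refine integral_norm_sq_tsum_le_of_le (by linarith) (by simp [tailCoeff, ha0])
    (summable_norm_tailCoeff _ ha) hf fun n => ?_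
  rw [tailCoeff]
  split_ifs with hn
  · rw [norm_zero, zero_pow two_ne_zero, mul_zero]
    positivity
  · rcases eq_or_ne n 0 with rfl | h0
    · simp [ha0]
    rw [Finset.mem_Icc, Nat.le_floor_iff (by linarith), not_and, not_le] at hn
    have hnT := hn (Nat.one_le_iff_ne_zero.2 h0)
    have h0' : (0 : ℝ) < n := by linarith
    rw [norm_mul, Complex.norm_of_nonneg (by positivity), mul_pow, ← Real.rpow_natCast (_ ^ _),
      ← Real.rpow_mul h0'.le, show -(3 / 2 : ℝ) * (2 : ℕ) = -(3 : ℕ) by norm_num,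
      Real.rpow_neg h0'.le, Real.rpow_natCast]
    calc _ = ‖a n‖ ^ 2 * ((T + n) * ((n : ℝ) ^ 3)⁻¹) := by ring
      _ ≤ ‖a n‖ ^ 2 * (6 * T⁻¹ * (n : ℝ) ^ (-(1 + 1 / Real.log T))) :=
        mul_le_mul_of_nonneg_left (rankin_weight_tail_le hT hnT) (by positivity)
      _ = _ := by ring

/-- The partial sum `∑ a n * n ^ (-s)` over `1 ≤ n ≤ N`. -/
noncomputable def headSum (a : ℕ → ℂ) (N : ℕ) (s : ℂ) : ℂ :=
  ∑ n ∈ Finset.Icc 1 N, a n * (n : ℂ) ^ (-s)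

lemma differentiable_headSum (a : ℕ → ℂ) (N : ℕ) : Differentiable ℂ (headSum a N) := by
  unfold headSum
  refine Differentiable.fun_sum fun n hn => Differentiable.const_mul ?_ _
  have : (n : ℂ) ≠ 0 := by
    have := (Finset.mem_Icc.1 hn).1
    exact_mod_cast (by omega : n ≠ 0)
  exact fun s => DifferentiableAt.const_cpow (by fun_prop) (Or.inl this)

lemma exists_norm_headSum_le (a : ℕ → ℂ) (N : ℕ) :
    ∃ C : ℝ, 0 ≤ C ∧ ∀ s : ℂ, -(1 / 2) ≤ s.re → ‖headSum a N s‖ ≤ C := by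
  refine ⟨∑ n ∈ Finset.Icc 1 N, ‖a n‖ * (n : ℝ) ^ (1 / 2 : ℝ), by positivity, fun s hs => ?_⟩
  refine (norm_sum_le _ _).trans (Finset.sum_le_sum fun n hn => ?_)
  have h1 : (1 : ℝ) ≤ n := by exact_mod_cast (Finset.mem_Icc.1 hn).1
  rw [norm_mul, ← ofReal_natCast, Complex.norm_cpow_eq_rpow_re_of_pos (by linarith)]
  gcongr
  simp only [neg_re]; linarith

lemma norm_cexp_sq_div (T : ℝ) (s : ℂ) :
    ‖cexp (s ^ 2 / (T ^ 2 : ℝ))‖ = Real.exp (s.re ^ 2 / T ^ 2) *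
      Real.exp (-(1 / T ^ 2) * s.im ^ 2) := by
  rw [Complex.norm_exp, ← Real.exp_add, Complex.div_ofReal_re, pow_two, mul_re]
  congr 1
  ring

lemma norm_cexp_sq_div_le {T : ℝ} (hT : 3 ≤ T) {s : ℂ} (h1 : -(1 / 2) ≤ s.re) (h2 : s.re ≤ 3 / 2) :
    ‖cexp (s ^ 2 / (T ^ 2 : ℝ))‖ ≤ 2 * Real.exp (-(1 / T ^ 2) * s.im ^ 2) := by
  rw [norm_cexp_sq_div]
  gcongr
  have : s.re ^ 2 / T ^ 2 ≤ 1 / 4 := by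
    rw [div_le_iff₀ (by positivity)]
    nlinarith
  have h3 := Real.exp_le_exp.2 (this.trans (by norm_num : (1 / 4 : ℝ) ≤ 1 / 2))
  have h4 : Real.exp (1 / 2) ≤ 2 := by
    have h5 : Real.exp (1 / 2) * Real.exp (1 / 2) = Real.exp 1 := by
      rw [← Real.exp_add]; norm_num
    nlinarith [Real.exp_one_lt_d9, Real.exp_pos (1 / 2)]
  linarith

lemma exp_neg_four_le_norm_cexp_sq_div {T : ℝ} (hT : 0 < T) {s : ℂ} (h : s.im ^ 2 ≤ 4 * T ^ 2) :
    Real.exp (-4) ≤ ‖cexp (s ^ 2 / (T ^ 2 : ℝ))‖ := by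
  rw [norm_cexp_sq_div, ← Real.exp_add]
  refine Real.exp_le_exp.2 ?_
  have h1 : 0 ≤ s.re ^ 2 / T ^ 2 := by positivity
  have h2 : 1 / T ^ 2 * s.im ^ 2 ≤ 4 := by
    rw [one_div_mul_eq_div, div_le_iff₀ (by positivity)]
    exact h
  linarith

lemma exp_mul_abs_mul_gaussian_le {T : ℝ} (hT : 0 < T) (t : ℝ) :
    Real.exp (8 * |t|) * Real.exp (-(1 / T ^ 2) * t ^ 2) ≤
      Real.exp (32 * T ^ 2) * Real.exp (-(1 / (2 * T ^ 2)) * t ^ 2) := by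
  rw [← Real.exp_add, ← Real.exp_add]
  refine Real.exp_le_exp.2 ?_
  have : 0 ≤ (|t| - 8 * T ^ 2) ^ 2 / (2 * T ^ 2) := by positivity
  have e : (|t| - 8 * T ^ 2) ^ 2 / (2 * T ^ 2) =
      1 / (2 * T ^ 2) * t ^ 2 - 8 * |t| + 32 * T ^ 2 := by
    rw [← sq_abs t]
    field_simp
    ring
  have e2 : 1 / T ^ 2 * t ^ 2 = 1 / (2 * T ^ 2) * t ^ 2 + 1 / (2 * T ^ 2) * t ^ 2 := by
    field_simp
    norm_num
  linarith

lemma norm_sub_one_le_of_strip {s : ℂ} (h1 : -(1 / 2) ≤ s.re) (h2 : s.re ≤ 3 / 2) :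
    ‖s - 1‖ ≤ 2 * (1 + |s.im|) := by
  refine (Complex.norm_le_abs_re_add_abs_im _).trans ?_
  simp only [sub_re, one_re, sub_im, one_im, sub_zero]
  have : |s.re - 1| ≤ 3 / 2 := abs_le.2 ⟨by linarith, by linarith⟩
  linarith [abs_nonneg s.im]

/-- The function compared on three vertical lines: an entire function `P` minus its two
approximating Dirichlet polynomials, smoothed by a Gaussian. -/
noncomputable def smoothedRemainder (P Y : ℂ → ℂ) (a b : ℕ → ℂ) (T : ℝ) (s : ℂ) : ℂ :=
  cexp (s ^ 2 / (T ^ 2 : ℝ)) *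
    (P s - ((s - 1) ^ 4 * headSum a ⌊T⌋₊ s + Y s * headSum b ⌊T⌋₊ (1 - s)))

lemma differentiableAt_smoothedRemainder {P Y : ℂ → ℂ} (a b : ℕ → ℂ) (T : ℝ) {s : ℂ}
    (hP : DifferentiableAt ℂ P s) (hY : DifferentiableAt ℂ Y s) :
    DifferentiableAt ℂ (smoothedRemainder P Y a b T) s := by
  have h1 := differentiable_headSum a ⌊T⌋₊ s
  have h2 : DifferentiableAt ℂ (fun s => headSum b ⌊T⌋₊ (1 - s)) s :=
    (differentiable_headSum b ⌊T⌋₊ (1 - s)).comp s (by fun_prop)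
  unfold smoothedRemainder
  fun_prop

lemma exists_norm_smoothedRemainder_le {P Y : ℂ → ℂ} (a b : ℕ → ℂ) {T C : ℝ} (hT : 3 ≤ T)
    (hC : 0 ≤ C)
    (hP : ∀ s : ℂ, -(1 / 2) ≤ s.re → s.re ≤ 3 / 2 → ‖P s‖ ≤ C * Real.exp (8 * |s.im|))
    (hY : ∀ s : ℂ, -(1 / 2) ≤ s.re → s.re ≤ 3 / 2 → ‖Y s‖ ≤ C * Real.exp (8 * |s.im|)) :
    ∃ B : ℝ, ∀ s : ℂ, -(1 / 2) ≤ s.re → s.re ≤ 3 / 2 →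
      ‖smoothedRemainder P Y a b T s‖ ≤ B * Real.exp (-(1 / (2 * T ^ 2)) * s.im ^ 2) := by
  obtain ⟨K₁, hK₁, h1⟩ := exists_norm_headSum_le a ⌊T⌋₊
  obtain ⟨K₂, hK₂, h2⟩ := exists_norm_headSum_le b ⌊T⌋₊
  refine ⟨2 * (C + (16 * K₁ + C * K₂)) * Real.exp (32 * T ^ 2), fun s hs1 hs2 => ?_⟩
  have h3 := h1 s hs1
  have h4 := h2 (1 - s) (by simp only [sub_re, one_re]; linarith)
  have h5 : ‖(s - 1) ^ 4‖ ≤ 16 * Real.exp (8 * |s.im|) := by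
    have h6 : 1 + |s.im| ≤ Real.exp (2 * |s.im|) := by
      linarith [Real.add_one_le_exp (2 * |s.im|), abs_nonneg s.im]
    rw [norm_pow, show 8 * |s.im| = (4 : ℕ) * (2 * |s.im|) by push_cast; ring, Real.exp_nat_mul]
    calc _ ≤ (2 * (1 + |s.im|)) ^ 4 := by gcongr; exact norm_sub_one_le_of_strip hs1 hs2
      _ = 16 * (1 + |s.im|) ^ 4 := by ring
      _ ≤ _ := by gcongr
  have h7 : ‖P s - ((s - 1) ^ 4 * headSum a ⌊T⌋₊ s + Y s * headSum b ⌊T⌋₊ (1 - s))‖ ≤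
      (C + (16 * K₁ + C * K₂)) * Real.exp (8 * |s.im|) := by
    refine (norm_sub_le _ _).trans ?_
    have h8 := norm_add_le ((s - 1) ^ 4 * headSum a ⌊T⌋₊ s) (Y s * headSum b ⌊T⌋₊ (1 - s))
    rw [norm_mul, norm_mul] at h8
    have h9 := mul_le_mul h5 h3 (norm_nonneg _) (by positivity)
    have h10 := mul_le_mul (hY s hs1 hs2) h4 (norm_nonneg _) (by positivity)
    linarith [hP s hs1 hs2]
  rw [smoothedRemainder, norm_mul]
  calc _ ≤ 2 * Real.exp (-(1 / T ^ 2) * s.im ^ 2) *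
        ((C + (16 * K₁ + C * K₂)) * Real.exp (8 * |s.im|)) := by
        gcongr
        exact norm_cexp_sq_div_le hT hs1 hs2
    _ = 2 * (C + (16 * K₁ + C * K₂)) *
        (Real.exp (8 * |s.im|) * Real.exp (-(1 / T ^ 2) * s.im ^ 2)) := by ring
    _ ≤ 2 * (C + (16 * K₁ + C * K₂)) *
        (Real.exp (32 * T ^ 2) * Real.exp (-(1 / (2 * T ^ 2)) * s.im ^ 2)) := by
        refine mul_le_mul_of_nonneg_left (exp_mul_abs_mul_gaussian_le (by linarith) _) ?_
        positivity
    _ = _ := by ring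

lemma integral_norm_sq_line_le {Y : ℂ → ℂ} {T C B₁ B₂ b₁ b₂ σ : ℝ} (hT : 3 ≤ T) (hC : 0 < C)
    (h1 : -(1 / 2) ≤ σ) (h2 : σ ≤ 3 / 2) {k : ℕ} (hk : k ≤ 6)
    (hY : ∀ t : ℝ, ‖Y (σ + t * I)‖ ≤ C * (1 + |t|) ^ k) {G D₁ D₂ : ℝ → ℂ} (hG0 : Continuous G)
    (hG : ∀ t : ℝ, G t = cexp ((σ + t * I) ^ 2 / (T ^ 2 : ℝ)) *
      ((σ + t * I - 1) ^ 4 * D₁ t + Y (σ + t * I) * D₂ t))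
    (hD₁ : Continuous D₁) (hD₂ : Continuous D₂) (hb₁ : ∀ t, ‖D₁ t‖ ≤ b₁) (hb₂ : ∀ t, ‖D₂ t‖ ≤ b₂)
    (hB₁ : ∫ t : ℝ, ‖D₁ t‖ ^ 2 * Real.exp (-(1 / T ^ 2) * t ^ 2) ≤ B₁)
    (hB₂ : ∫ t : ℝ, ‖D₂ t‖ ^ 2 * Real.exp (-(1 / T ^ 2) * t ^ 2) ≤ B₂) :
    Integrable (fun t => ‖G t‖ ^ 2) ∧ ∫ t : ℝ, ‖G t‖ ^ 2 ≤
      2 * (2 * (16 + C)) ^ 2 * (2 ^ 6 * (6).factorial * Real.exp 1) *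
        (T ^ 8 * B₁ + T ^ (2 * k) * B₂) := by
  have hfac (j : ℕ) (hj : j ≤ 6) : (2 : ℝ) ^ j * j.factorial ≤ 2 ^ 6 * (6).factorial := by
    have h3 : (j.factorial : ℝ) ≤ (6).factorial := by exact_mod_cast Nat.factorial_le hj
    have h4 : (2 : ℝ) ^ j ≤ 2 ^ 6 := pow_le_pow_right₀ (by norm_num) hj
    gcongr
  have hB₁0 : 0 ≤ B₁ := le_trans (integral_nonneg fun t => by positivity) hB₁
  have hB₂0 : 0 ≤ B₂ := le_trans (integral_nonneg fun t => by positivity) hB₂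
  have hG' (t : ℝ) : ‖G t‖ ≤ 2 * (16 + C) * ((1 + |t|) ^ 4 * Real.exp (-(1 / T ^ 2) * t ^ 2)) *
        ‖D₁ t‖ + 2 * (16 + C) * ((1 + |t|) ^ k * Real.exp (-(1 / T ^ 2) * t ^ 2)) * ‖D₂ t‖ := by
    have hre : (σ + t * I : ℂ).re = σ := by simp
    have him : (σ + t * I : ℂ).im = t := by simp
    have e1 := norm_cexp_sq_div_le hT (s := σ + t * I) (by rwa [hre]) (by rwa [hre])
    have e2 := norm_sub_one_le_of_strip (s := σ + t * I) (by rwa [hre]) (by rwa [hre])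
    rw [him] at e1 e2
    have e3 : ‖(σ + t * I - 1 : ℂ) ^ 4‖ ≤ (16 + C) * (1 + |t|) ^ 4 := by
      rw [norm_pow]
      calc _ ≤ (2 * (1 + |t|)) ^ 4 := by gcongr
        _ = 16 * (1 + |t|) ^ 4 := by ring
        _ ≤ _ := by gcongr; linarith
    have e4 : ‖Y (σ + t * I)‖ ≤ (16 + C) * (1 + |t|) ^ k :=
      (hY t).trans (by gcongr; linarith)
    rw [hG t, norm_mul]
    calc _ ≤ 2 * Real.exp (-(1 / T ^ 2) * t ^ 2) * ((16 + C) * (1 + |t|) ^ 4 * ‖D₁ t‖ +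
          (16 + C) * (1 + |t|) ^ k * ‖D₂ t‖) := by
          gcongr
          refine (norm_add_le _ _).trans ?_
          rw [norm_mul, norm_mul]
          gcongr
      _ = _ := by ring
  obtain ⟨hi, hle⟩ := integral_norm_sq_le_of_two_terms (by linarith) 4 k hG0 hG' hD₁ hD₂ hb₁ hb₂
    hB₁ hB₂
  refine ⟨hi, hle.trans ?_⟩
  have h5 := hfac 4 (by norm_num)
  have h6 := hfac k hk
  have h7 : 0 ≤ T := by linarith
  calc _ ≤ 2 * (2 * (16 + C)) ^ 2 * (2 ^ 6 * (6).factorial * Real.exp 1) * T ^ (2 * 4) * B₁ +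
        2 * (2 * (16 + C)) ^ 2 * (2 ^ 6 * (6).factorial * Real.exp 1) * T ^ (2 * k) * B₂ := by
        gcongr
    _ = _ := by ring

/-- Mean square on the critical line, over dyadic intervals, of a function of degree two
satisfying a functional equation, in terms of its Dirichlet coefficients. -/
theorem exists_integral_norm_sq_le_of_functional_equation {a b : ℕ → ℂ}
    (hab : ∀ n, ‖b n‖ = ‖a n‖) (ha0 : a 0 = 0)
    (ha : Summable fun n : ℕ => ‖a n‖ * (n : ℝ) ^ (-(3 / 2 : ℝ)))
    (ha2 : ∀ σ : ℝ, 1 < σ → σ ≤ 2 → Summable fun n : ℕ => ‖a n‖ ^ 2 * (n : ℝ) ^ (-σ))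
    {P Y : ℂ → ℂ} {C : ℝ} (hC : 0 < C) (hP : Differentiable ℂ P)
    (hY : ∀ s : ℂ, s.re < 2 → DifferentiableAt ℂ Y s)
    (hP_right : ∀ t : ℝ, P ((3 / 2 : ℝ) + t * I) = (((3 / 2 : ℝ) : ℂ) + t * I - 1) ^ 4 *
      ∑' n : ℕ, a n * (n : ℂ) ^ (-(((3 / 2 : ℝ) : ℂ) + t * I)))
    (hP_left : ∀ t : ℝ, P ((-(1 / 2) : ℝ) + t * I) = Y ((-(1 / 2) : ℝ) + t * I) *
      ∑' n : ℕ, b n * (n : ℂ) ^ (-(((3 / 2 : ℝ) : ℂ) + (-t : ℝ) * I)))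
    (hY_left : ∀ t : ℝ, ‖Y ((-(1 / 2) : ℝ) + t * I)‖ ≤ C * (1 + |t|) ^ 6)
    (hY_mid : ∀ t : ℝ, ‖Y ((1 / 2 : ℝ) + t * I)‖ ≤ C * (1 + |t|) ^ 4)
    (hY_right : ∀ t : ℝ, ‖Y ((3 / 2 : ℝ) + t * I)‖ ≤ C * (1 + |t|) ^ 2)
    (hP_le : ∀ s : ℂ, -(1 / 2) ≤ s.re → s.re ≤ 3 / 2 → ‖P s‖ ≤ C * Real.exp (8 * |s.im|))
    (hY_le : ∀ s : ℂ, -(1 / 2) ≤ s.re → s.re ≤ 3 / 2 → ‖Y s‖ ≤ C * Real.exp (8 * |s.im|)) :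
    ∃ K : ℝ, 0 < K ∧ ∀ T : ℝ, 3 ≤ T → ∫ t in T..(2 * T), ‖P ((1 / 2 : ℝ) + t * I)‖ ^ 2 ≤
      K * T ^ 9 * ∑' n : ℕ, ‖a n‖ ^ 2 * (n : ℝ) ^ (-(1 + 1 / Real.log T)) := by
  have hb0 : b 0 = 0 := by rw [← norm_eq_zero, hab, ha0, norm_zero]
  have hb : Summable fun n : ℕ => ‖b n‖ * (n : ℝ) ^ (-(3 / 2 : ℝ)) := by simpa only [hab] using ha
  set K₀ : ℝ := 2 * (2 * (16 + C)) ^ 2 * (2 ^ 6 * (6).factorial * Real.exp 1) with hK₀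
  have hK₀0 : 0 < K₀ := by positivity
  refine ⟨Real.exp 8 * (720 * K₀), by positivity, fun T hT => ?_⟩
  have hT0 : 0 < T := by linarith
  have hlog : 1 ≤ Real.log T := by
    rw [Real.le_log_iff_exp_le hT0]; linarith [Real.exp_one_lt_d9]
  have hf := ha2 (1 + 1 / Real.log T) (by have : 0 < 1 / Real.log T := by positivity
                                          linarith)
    (by have : 1 / Real.log T ≤ 1 := (div_le_one (by linarith)).2 hlog
        linarith)
  have hfb : Summable fun n : ℕ => ‖b n‖ ^ 2 * (n : ℝ) ^ (-(1 + 1 / Real.log T)) := by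
    simpa only [hab] using hf
  set A := ∑' n : ℕ, ‖a n‖ ^ 2 * (n : ℝ) ^ (-(1 + 1 / Real.log T)) with hA
  have hAb : ∑' n : ℕ, ‖b n‖ ^ 2 * (n : ℝ) ^ (-(1 + 1 / Real.log T)) = A := by
    simp only [hab, hA]
  have hA0 : 0 ≤ A := tsum_nonneg fun n => by positivity
  set N := ⌊T⌋₊ with hN
  set g := smoothedRemainder P Y a b T with hg
  -- the mean values of the Dirichlet series involved
  have neg_bd {c : ℕ → ℂ} (hc : Summable fun n => ‖c n‖) (t : ℝ) :
      ‖lineSeries c (-t)‖ ≤ ∑' n, ‖c n‖ := norm_tsum_mul_cexp_le hc (-t)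
  have neg_ct {c : ℕ → ℂ} (hc : Summable fun n => ‖c n‖) :
      Continuous fun t => lineSeries c (-t) := (continuous_lineSeries hc).comp continuous_neg
  have mv1 := integral_norm_sq_head_neg_half_le hT hf
  have mvNeg1 := (integral_norm_sq_lineSeries_neg _ T).trans_le
    (integral_norm_sq_head_neg_half_le hT hfb)
  have mv2 := integral_norm_sq_head_half_le hT hf
  have mvNeg2 := (integral_norm_sq_lineSeries_neg _ T).trans_le
    (integral_norm_sq_head_half_le hT hfb)
  have mv3 := integral_norm_sq_tail_le hT hf ha0 ha
  have mvNeg3 := (integral_norm_sq_lineSeries_neg _ T).trans_le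
    (integral_norm_sq_tail_le hT hfb hb0 hb)
  rw [hAb] at mvNeg1 mvNeg2 mvNeg3
  rw [← hA] at mv1 mv2 mv3
  clear_value A
  -- evaluation of the partial sums on vertical lines
  have hsum (c : ℕ → ℂ) (σ t : ℝ) : headSum c N (σ + t * I) = lineSeries (headCoeff c N σ) t :=
    sum_Icc_mul_cpow_eq c N σ t
  have hsub {σ τ : ℝ} (h : 1 - σ = τ) (t : ℝ) :
      (1 : ℂ) - (σ + t * I) = (τ : ℂ) + ((-t : ℝ) : ℂ) * I := by
    rw [← h]; push_cast; ring
  have hdiff (s : ℂ) (hs : s.re < 2) : DifferentiableAt ℂ g s :=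
    differentiableAt_smoothedRemainder a b T (hP s) (hY s hs)
  have hline {σ : ℝ} (hσ : σ < 2) : Continuous fun t : ℝ => g (σ + t * I) :=
    continuous_iff_continuousAt.2 fun t =>
      ContinuousAt.comp (f := fun t : ℝ => (σ + t * I : ℂ))
        (hdiff (σ + t * I) (by simpa using hσ)).continuousAt (by fun_prop)
  -- the right line
  have hright := (integral_norm_sq_line_le hT hC (σ := 3 / 2) (by norm_num) le_rfl (by norm_num)
    hY_right (hline (σ := 3 / 2) (by norm_num)) (D₁ := lineSeries (tailCoeff a N (3 / 2)))
    (D₂ := fun t => -lineSeries (headCoeff b N (-(1 / 2))) (-t)) (fun t => by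
      rw [hg, smoothedRemainder, hP_right, tsum_mul_cpow_eq ha0 N t ha, sum_Icc_mul_cpow_eq,
        hsub (τ := -(1 / 2)) (by norm_num), hsum, hsum]
      ring)
    (continuous_lineSeries (summable_norm_tailCoeff N ha))
    (neg_ct (summable_norm_headCoeff b N _)).neg
    (norm_tsum_mul_cexp_le (summable_norm_tailCoeff N ha))
    (fun t => (norm_neg _).trans_le (neg_bd (summable_norm_headCoeff b N _) t)) mv3
    (by simpa only [norm_neg] using mvNeg1)).2
  -- the left line
  have hleft := (integral_norm_sq_line_le hT hC (σ := -(1 / 2)) le_rfl (by norm_num) le_rfl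
    hY_left (hline (σ := -(1 / 2)) (by norm_num)) (D₁ := fun t => -lineSeries (headCoeff a N (-(1 / 2))) t)
    (D₂ := fun t => lineSeries (tailCoeff b N (3 / 2)) (-t)) (fun t => by
      rw [hg, smoothedRemainder, hP_left, tsum_mul_cpow_eq hb0 N (-t) hb, sum_Icc_mul_cpow_eq,
        hsub (τ := 3 / 2) (by norm_num), hsum, hsum]
      ring)
    (continuous_lineSeries (summable_norm_headCoeff a N _)).neg
    (neg_ct (summable_norm_tailCoeff N hb))
    (fun t => (norm_neg _).trans_le (norm_tsum_mul_cexp_le (summable_norm_headCoeff a N _) t))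
    (neg_bd (summable_norm_tailCoeff N hb)) (by simpa only [norm_neg] using mv1) mvNeg3).2
  -- the two polynomials on the critical line
  set R : ℝ → ℂ := fun t => cexp ((((1 / 2 : ℝ) : ℂ) + t * I) ^ 2 / (T ^ 2 : ℝ)) *
    ((((1 / 2 : ℝ) : ℂ) + t * I - 1) ^ 4 * lineSeries (headCoeff a N (1 / 2)) t +
      Y (((1 / 2 : ℝ) : ℂ) + t * I) * lineSeries (headCoeff b N (1 / 2)) (-t)) with hR
  have hgR (t : ℝ) : cexp ((((1 / 2 : ℝ) : ℂ) + t * I) ^ 2 / (T ^ 2 : ℝ)) *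
      P (((1 / 2 : ℝ) : ℂ) + t * I) = g (((1 / 2 : ℝ) : ℂ) + t * I) + R t := by
    rw [hg, smoothedRemainder, hsub (τ := 1 / 2) (by norm_num), hsum, hsum, hR]
    ring
  have hYc : Continuous fun t : ℝ => Y (((1 / 2 : ℝ) : ℂ) + t * I) :=
    continuous_iff_continuousAt.2 fun t =>
      ContinuousAt.comp (f := fun t : ℝ => (((1 / 2 : ℝ) : ℂ) + t * I : ℂ))
        (hY _ (by simp; norm_num)).continuousAt (by fun_prop)
  have hRc : Continuous R := by
    have c1 := continuous_lineSeries (summable_norm_headCoeff a N (1 / 2))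
    have c2 := neg_ct (summable_norm_headCoeff b N (1 / 2))
    exact Continuous.mul (by fun_prop) (((Continuous.pow (by fun_prop) 4).mul c1).add (hYc.mul c2))
  obtain ⟨hRi, hmid⟩ := integral_norm_sq_line_le hT hC (σ := 1 / 2) (by norm_num) (by norm_num)
    (by norm_num) hY_mid hRc (fun t => rfl)
    (continuous_lineSeries (summable_norm_headCoeff a N _))
    (neg_ct (summable_norm_headCoeff b N _))
    (norm_tsum_mul_cexp_le (summable_norm_headCoeff a N _))
    (neg_bd (summable_norm_headCoeff b N _)) mv2 mvNeg2
  rw [← hK₀] at hright hleft hmid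
  clear_value K₀
  obtain ⟨B, hB⟩ := exists_norm_smoothedRemainder_le a b hT hC.le hP_le hY_le
  have hconv := sq_integral_norm_sq_le_of_strip (g := g) (ε := 1 / (2 * T ^ 2)) (by positivity)
    (fun s _ hs => hdiff s hs) hB
  have c1 : ((1 / 2 : ℝ) : ℂ) = 1 / 2 := by push_cast; rfl
  have c2 : ((3 / 2 : ℝ) : ℂ) = 3 / 2 := by push_cast; rfl
  have c3 : ((-(1 / 2) : ℝ) : ℂ) = -(1 / 2) := by push_cast; rfl
  rw [← c3, ← c2, ← c1] at hconv
  have hgi : Integrable fun t : ℝ => ‖g (((1 / 2 : ℝ) : ℂ) + t * I)‖ ^ 2 := by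
    refine ((integrable_exp_neg_mul_sq (b := 1 / T ^ 2) (by positivity)).const_mul (B ^ 2)).mono'
      ((hline (σ := 1 / 2) (by norm_num)).norm.pow 2).aestronglyMeasurable
      (Eventually.of_forall fun t => ?_)
    have hre : (((1 / 2 : ℝ) : ℂ) + t * I).re = 1 / 2 := by simp
    have him : (((1 / 2 : ℝ) : ℂ) + t * I).im = t := by simp
    have h1 := hB (((1 / 2 : ℝ) : ℂ) + t * I) (by rw [hre]; norm_num) (by rw [hre]; norm_num)
    rw [him] at h1
    rw [Real.norm_of_nonneg (by positivity)]
    refine (pow_le_pow_left₀ (norm_nonneg _) h1 2).trans_eq ?_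
    rw [mul_pow, ← Real.exp_nat_mul]
    congr 2
    push_cast
    field_simp
  have hJ : ∫ t : ℝ, ‖g (((1 / 2 : ℝ) : ℂ) + t * I)‖ ^ 2 ≤ 180 * K₀ * T ^ 9 * A := by
    refine (sq_le_sq₀ (integral_nonneg fun t => by positivity) (by positivity)).1
      (hconv.trans ((mul_le_mul hleft hright (integral_nonneg fun t => by positivity)
        (by positivity)).trans_eq ?_))
    field_simp
    ring
  have hRJ : ∫ t : ℝ, ‖R t‖ ^ 2 ≤ 180 * K₀ * T ^ 9 * A := hmid.trans_eq (by ring)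
  have hpt (t : ℝ) (ht : t ∈ Set.Icc T (2 * T)) : ‖P (((1 / 2 : ℝ) : ℂ) + t * I)‖ ^ 2 ≤
      Real.exp 8 * (2 * ‖g (((1 / 2 : ℝ) : ℂ) + t * I)‖ ^ 2 + 2 * ‖R t‖ ^ 2) := by
    have him : (((1 / 2 : ℝ) : ℂ) + t * I).im = t := by simp
    have h1 := exp_neg_four_le_norm_cexp_sq_div hT0 (s := ((1 / 2 : ℝ) : ℂ) + t * I)
      (by rw [him]; nlinarith [ht.1, ht.2])
    have h2 : Real.exp (-4) * ‖P (((1 / 2 : ℝ) : ℂ) + t * I)‖ ≤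
        ‖g (((1 / 2 : ℝ) : ℂ) + t * I)‖ + ‖R t‖ := by
      refine le_trans ?_ (norm_add_le _ _)
      rw [← hgR, norm_mul]
      gcongr
    have h3 : Real.exp 8 * Real.exp (-4) ^ 2 = 1 := by
      rw [← Real.exp_nat_mul, ← Real.exp_add, Real.exp_eq_one_iff]; norm_num
    calc _ = Real.exp 8 * (Real.exp (-4) * ‖P (((1 / 2 : ℝ) : ℂ) + t * I)‖) ^ 2 := by
          rw [mul_pow, ← mul_assoc, h3, one_mul]
      _ ≤ Real.exp 8 * (‖g (((1 / 2 : ℝ) : ℂ) + t * I)‖ + ‖R t‖) ^ 2 := by gcongr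
      _ ≤ _ := by
        gcongr
        nlinarith [sq_nonneg (‖g (((1 / 2 : ℝ) : ℂ) + t * I)‖ - ‖R t‖)]
  have hi : Integrable fun t : ℝ =>
      Real.exp 8 * (2 * ‖g (((1 / 2 : ℝ) : ℂ) + t * I)‖ ^ 2 + 2 * ‖R t‖ ^ 2) :=
    ((hgi.const_mul 2).add (hRi.const_mul 2)).const_mul _
  have hPc : Continuous fun t : ℝ => ‖P (((1 / 2 : ℝ) : ℂ) + t * I)‖ ^ 2 := by
    have := hP.continuous
    fun_prop
  calc _ ≤ ∫ t in T..(2 * T),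
        Real.exp 8 * (2 * ‖g (((1 / 2 : ℝ) : ℂ) + t * I)‖ ^ 2 + 2 * ‖R t‖ ^ 2) :=
        intervalIntegral.integral_mono_on (by linarith) (hPc.intervalIntegrable _ _)
          hi.intervalIntegrable hpt
    _ ≤ ∫ t : ℝ, Real.exp 8 * (2 * ‖g (((1 / 2 : ℝ) : ℂ) + t * I)‖ ^ 2 + 2 * ‖R t‖ ^ 2) := by
        rw [intervalIntegral.integral_of_le (by linarith)]
        exact setIntegral_le_integral hi (Eventually.of_forall fun t => by positivity)
    _ = Real.exp 8 * (2 * ∫ t : ℝ, ‖g (((1 / 2 : ℝ) : ℂ) + t * I)‖ ^ 2) +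
        Real.exp 8 * (2 * ∫ t : ℝ, ‖R t‖ ^ 2) := by
        rw [integral_const_mul, integral_add (hgi.const_mul 2) (hRi.const_mul 2),
          integral_const_mul, integral_const_mul, mul_add]
    _ ≤ Real.exp 8 * (2 * (180 * K₀ * T ^ 9 * A)) + Real.exp 8 * (2 * (180 * K₀ * T ^ 9 * A)) := by
        gcongr
    _ = _ := by ring

lemma charConv_apply {M N : ℕ} (χ : DirichletCharacter ℂ M) (ψ : DirichletCharacter ℂ N) (n : ℕ) :
    charConv χ ψ n = ∑ p ∈ n.divisorsAntidiagonal, χ p.1 * ψ p.2 :=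
  congrFun (LSeries.convolution_def (fun n : ℕ => χ n) (fun n : ℕ => ψ n)) n

lemma norm_charConv_inv {M N : ℕ} (χ : DirichletCharacter ℂ M) (ψ : DirichletCharacter ℂ N)
    (n : ℕ) : ‖charConv χ⁻¹ ψ⁻¹ n‖ = ‖charConv χ ψ n‖ := by
  rw [← RCLike.norm_conj (charConv χ ψ n), charConv_apply, charConv_apply, map_sum]
  congr 1
  refine Finset.sum_congr rfl fun p _ => ?_
  rw [map_mul, ← MulChar.star_eq_inv, ← MulChar.star_eq_inv, MulChar.star_apply,
    MulChar.star_apply]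
  rfl

lemma LSeriesSummable_charConv {M N : ℕ} [NeZero M] [NeZero N] (χ : DirichletCharacter ℂ M)
    (ψ : DirichletCharacter ℂ N) {s : ℂ} (hs : 1 < s.re) : LSeriesSummable (charConv χ ψ) s :=
  (χ.LSeriesSummable_of_one_lt_re hs).convolution (ψ.LSeriesSummable_of_one_lt_re hs)

lemma term_charConv {M N : ℕ} (χ : DirichletCharacter ℂ M)
    (ψ : DirichletCharacter ℂ N) (s : ℂ) (n : ℕ) :
    LSeries.term (charConv χ ψ) s n = charConv χ ψ n * (n : ℂ) ^ (-s) := by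
  rcases eq_or_ne n 0 with rfl | hn
  · simp
  · rw [LSeries.term_of_ne_zero hn, Complex.cpow_neg, div_eq_mul_inv]

lemma tsum_charConv_mul_cpow {M N : ℕ} [NeZero M] [NeZero N] (χ : DirichletCharacter ℂ M)
    (ψ : DirichletCharacter ℂ N) {s : ℂ} (hs : 1 < s.re) :
    ∑' n : ℕ, charConv χ ψ n * (n : ℂ) ^ (-s) = χ.LFunction s * ψ.LFunction s := by
  rw [χ.LFunction_eq_LSeries hs, ψ.LFunction_eq_LSeries hs,
    ← LSeries_convolution' (χ.LSeriesSummable_of_one_lt_re hs)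
      (ψ.LSeriesSummable_of_one_lt_re hs)]
  exact tsum_congr fun n => (term_charConv χ ψ s n).symm

lemma summable_norm_charConv {M N : ℕ} [NeZero M] [NeZero N] (χ : DirichletCharacter ℂ M)
    (ψ : DirichletCharacter ℂ N) :
    Summable fun n : ℕ => ‖charConv χ ψ n‖ * (n : ℝ) ^ (-(3 / 2 : ℝ)) := by
  have h := (LSeriesSummable_charConv χ ψ (s := (3 / 2 : ℝ))
    (by rw [ofReal_re]; norm_num)).norm
  refine h.congr fun n => ?_
  rw [term_charConv, norm_mul, ← ofReal_neg, ← ofReal_natCast]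
  rcases eq_or_ne n 0 with rfl | hn
  · simp
  · rw [Complex.norm_cpow_eq_rpow_re_of_pos (by positivity), ofReal_re]

/-- Mean square of a product of two primitive Dirichlet L-functions on the critical line. -/
theorem exists_integral_norm_sq_LFunction_mul_le_of_isPrimitive {M N : ℕ} [NeZero M] [NeZero N]
    {χ : DirichletCharacter ℂ M} {ψ : DirichletCharacter ℂ N} (hχ : χ.IsPrimitive)
    (hψ : ψ.IsPrimitive) : ∃ K, 0 < K ∧ ∀ T : ℝ, 3 ≤ T →
      ∫ t in T..(2 * T), ‖χ.LFunction (1 / 2 + t * I) * ψ.LFunction (1 / 2 + t * I)‖ ^ 2 ≤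
        K * T * ∑' n : ℕ, ‖charConv χ ψ n‖ ^ 2 * (n : ℝ) ^ (-(1 + 1 / Real.log T)) := by
  obtain ⟨_, -, hser⟩ := exists_tsum_norm_sq_charConv_le χ ψ
  obtain ⟨A₁, hA₁, hreg₁⟩ := exists_norm_regularizedLFunction_le χ
  obtain ⟨A₂, hA₂, hreg₂⟩ := exists_norm_regularizedLFunction_le ψ
  obtain ⟨E₁, hE₁, hexp₁⟩ := exists_norm_functionalEquationFactor_le_exp χ
  obtain ⟨E₂, hE₂, hexp₂⟩ := exists_norm_functionalEquationFactor_le_exp ψ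
  have hline (k : ℕ) (hk : k ≤ 2) : ∃ C, 0 < C ∧ ∀ t : ℝ,
      ‖functionalEquationFactor χ (3 / 2 - k + t * I) *
        functionalEquationFactor ψ (3 / 2 - k + t * I)‖ ≤ C * (1 + |t|) ^ (2 * k + 2) := by
    obtain ⟨C₁, hC₁, h₁⟩ := exists_norm_functionalEquationFactor_line_le χ hk
    obtain ⟨C₂, hC₂, h₂⟩ := exists_norm_functionalEquationFactor_line_le ψ hk
    refine ⟨C₁ * C₂, by positivity, fun t => ?_⟩
    rw [norm_mul]
    calc _ ≤ (C₁ * (1 + |t|) ^ (k + 1)) * (C₂ * (1 + |t|) ^ (k + 1)) := by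
          gcongr
          exacts [h₁ t, h₂ t]
      _ = _ := by ring
  obtain ⟨B₀, hB₀, hl₀⟩ := hline 0 (by norm_num)
  obtain ⟨B₁, hB₁, hl₁⟩ := hline 1 (by norm_num)
  obtain ⟨B₂, hB₂, hl₂⟩ := hline 2 (by norm_num)
  set P : ℂ → ℂ := fun s => (s - 1) ^ 2 * regularizedLFunction χ s * regularizedLFunction ψ s
    with hPdef
  set Y : ℂ → ℂ := fun s => functionalEquationFactor χ s * functionalEquationFactor ψ s with hYdef
  have hP1 (s : ℂ) (hs : s ≠ 1) :
      P s = (s - 1) ^ 4 * (χ.LFunction s * ψ.LFunction s) := by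
    simp only [hPdef]
    rw [regularizedLFunction_of_ne_one χ hs, regularizedLFunction_of_ne_one ψ hs]
    ring
  set C := 4 * A₁ * A₂ + E₁ * E₂ + B₀ + B₁ + B₂ with hCdef
  have hA := mul_pos (mul_pos four_pos hA₁) hA₂
  have hE := mul_pos hE₁ hE₂
  obtain ⟨K, hK, hmain⟩ := exists_integral_norm_sq_le_of_functional_equation
    (a := charConv χ ψ) (b := charConv χ⁻¹ ψ⁻¹) (P := P) (Y := Y) (C := C)
    (norm_charConv_inv χ ψ) (by simp) (summable_norm_charConv χ ψ)
    (fun σ h1 h2 => (hser σ h1 h2).1) (by positivity)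
    (((differentiable_id.sub_const 1).pow 2 |>.mul (differentiable_regularizedLFunction χ)).mul
      (differentiable_regularizedLFunction ψ))
    (fun s hs => (differentiableAt_functionalEquationFactor χ hs).mul
      (differentiableAt_functionalEquationFactor ψ hs))
    (fun t => by
      rw [tsum_charConv_mul_cpow _ _ (by simp; norm_num), hP1 _ fun h => ?_]
      have := congrArg Complex.re h
      norm_num at this)
    (fun t => by
      rw [tsum_charConv_mul_cpow _ _ (by simp; norm_num), hP1 _ fun h => ?_]
      · have h1 := hχ.sub_one_sq_mul_LFunction (s := (-(1 / 2) : ℝ) + t * I) (by simp)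
        have h2 := hψ.sub_one_sq_mul_LFunction (s := (-(1 / 2) : ℝ) + t * I) (by simp)
        have e : (1 : ℂ) - ((-(1 / 2) : ℝ) + t * I) = ((3 / 2 : ℝ) : ℂ) + (-t : ℝ) * I := by
          push_cast; ring
        rw [e] at h1 h2
        simp only [hYdef]
        linear_combination ((-(1 / 2) : ℝ) + t * I - 1) ^ 2 * ψ.LFunction ((-(1 / 2) : ℝ) + t * I) *
          h1 + functionalEquationFactor χ ((-(1 / 2) : ℝ) + t * I) *
            χ⁻¹.LFunction (((3 / 2 : ℝ) : ℂ) + (-t : ℝ) * I) * h2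
      · have := congrArg Complex.re h
        norm_num at this)
    (fun t => by
      have e : (((-(1 / 2) : ℝ) : ℂ) + t * I) = 3 / 2 - (2 : ℕ) + t * I := by push_cast; ring
      rw [e]
      refine (hl₂ t).trans ?_
      gcongr
      linarith)
    (fun t => by
      have e : (((1 / 2 : ℝ) : ℂ) + t * I) = 3 / 2 - (1 : ℕ) + t * I := by push_cast; ring
      rw [e]
      refine (hl₁ t).trans ?_
      gcongr
      linarith)
    (fun t => by
      have e : (((3 / 2 : ℝ) : ℂ) + t * I) = 3 / 2 - (0 : ℕ) + t * I := by push_cast; ring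
      rw [e]
      refine (hl₀ t).trans ?_
      gcongr
      linarith)
    (fun s h1 h2 => by
      simp only [hPdef]
      rw [norm_mul, norm_mul, norm_pow]
      have e0 : 1 + |s.im| ≤ Real.exp |s.im| := by linarith [Real.add_one_le_exp |s.im|]
      have e1 : ‖s - 1‖ ≤ 2 * Real.exp |s.im| :=
        (norm_sub_one_le_of_strip h1 h2).trans (by gcongr)
      calc _ ≤ (2 * Real.exp |s.im|) ^ 2 * (A₁ * Real.exp (3 * |s.im|)) *
            (A₂ * Real.exp (3 * |s.im|)) := by
            gcongr
            exacts [hreg₁ s h1 h2, hreg₂ s h1 h2]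
        _ = 4 * A₁ * A₂ * Real.exp (8 * |s.im|) := by
            rw [show 8 * |s.im| = |s.im| + |s.im| + (3 * |s.im| + 3 * |s.im|) by ring,
              Real.exp_add, Real.exp_add, Real.exp_add]
            ring
        _ ≤ _ := by gcongr; linarith)
    (fun s h1 h2 => by
      simp only [hYdef]
      rw [norm_mul]
      calc _ ≤ (E₁ * Real.exp (3 * |s.im|)) * (E₂ * Real.exp (3 * |s.im|)) := by
            gcongr
            exacts [hexp₁ s h1 h2, hexp₂ s h1 h2]
        _ = E₁ * E₂ * Real.exp (6 * |s.im|) := by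
            rw [show 6 * |s.im| = 3 * |s.im| + 3 * |s.im| by ring, Real.exp_add]
            ring
        _ ≤ C * Real.exp (8 * |s.im|) := by
            gcongr
            · linarith
            · norm_num)
  refine ⟨K, hK, fun T hT => ?_⟩
  have hT0 : 0 < T := by linarith
  have hPc : Continuous fun t : ℝ => ‖P ((1 / 2 : ℝ) + t * I)‖ ^ 2 := by
    have : Differentiable ℂ P :=
      ((differentiable_id.sub_const 1).pow 2 |>.mul (differentiable_regularizedLFunction χ)).mul
        (differentiable_regularizedLFunction ψ)
    exact ((this.continuous.comp (by fun_prop)).norm).pow 2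
  have hne (t : ℝ) : (1 / 2 + t * I : ℂ) ≠ 1 := fun h => by
    have := congrArg Complex.re h
    norm_num at this
  have hpt (t : ℝ) (ht : T ≤ t) : ‖χ.LFunction (1 / 2 + t * I) * ψ.LFunction (1 / 2 + t * I)‖ ^ 2 ≤
      (T ^ 8)⁻¹ * ‖P ((1 / 2 : ℝ) + t * I)‖ ^ 2 := by
    have e : (((1 / 2 : ℝ) : ℂ) + t * I) = 1 / 2 + t * I := by push_cast; ring
    rw [e, hP1 _ (hne t), norm_mul (_ ^ 4), norm_pow, mul_pow, ← pow_mul]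
    have h1 : T ≤ ‖(1 / 2 + t * I - 1 : ℂ)‖ := by
      refine le_trans ?_ (Complex.abs_im_le_norm _)
      simpa using ht.trans (le_abs_self t)
    rw [le_inv_mul_iff₀ (by positivity)]
    gcongr
  have hintegral : ∫ t in T..(2 * T), ‖χ.LFunction (1 / 2 + t * I) * ψ.LFunction (1 / 2 + t * I)‖ ^ 2 ≤
      ∫ t in T..(2 * T), (T ^ 8)⁻¹ * ‖P ((1 / 2 : ℝ) + t * I)‖ ^ 2 := by
    refine intervalIntegral.integral_mono_on (by linarith) (Continuous.intervalIntegrable ?_ _ _)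
      ((hPc.const_mul _).intervalIntegrable _ _) fun t ht => hpt t ht.1
    refine (Continuous.norm ?_).pow 2
    refine continuous_iff_continuousAt.2 fun t => ContinuousAt.mul ?_ ?_
    · exact (χ.differentiableAt_LFunction _ (Or.inl (hne t))).continuousAt.comp
        (f := fun t : ℝ => (1 / 2 + t * I : ℂ)) (by fun_prop)
    · exact (ψ.differentiableAt_LFunction _ (Or.inl (hne t))).continuousAt.comp
        (f := fun t : ℝ => (1 / 2 + t * I : ℂ)) (by fun_prop)
  refine hintegral.trans ?_
  rw [intervalIntegral.integral_const_mul, inv_mul_le_iff₀ (by positivity)]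
  exact (hmain T hT).trans (le_of_eq (by ring))

lemma continuous_LFunction_critical_line {N : ℕ} [NeZero N] (χ : DirichletCharacter ℂ N) :
    Continuous fun t : ℝ => χ.LFunction (1 / 2 + t * I) := by
  refine continuous_iff_continuousAt.2 fun t =>
    (χ.differentiableAt_LFunction _ (Or.inl fun h => ?_)).continuousAt.comp
      (f := fun t : ℝ => (1 / 2 + t * I : ℂ)) (by fun_prop)
  have := congrArg Complex.re h
  norm_num at this

lemma exists_norm_LFunction_le_primitiveCharacter {q : ℕ} [NeZero q] (χ : DirichletCharacter ℂ q)
    [NeZero χ.conductor] : ∃ E, 0 < E ∧ ∀ t : ℝ, ‖χ.LFunction (1 / 2 + t * I)‖ ≤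
      E * ‖χ.primitiveCharacter.LFunction (1 / 2 + t * I)‖ := by
  refine ⟨∏ _p ∈ q.primeFactors, 2, by positivity, fun t => ?_⟩
  have h : (1 / 2 + t * I : ℂ) ≠ 1 := fun h => by
    have := congrArg Complex.re h
    norm_num at this
  have h1 := DirichletCharacter.LFunction_changeLevel χ.conductor_dvd_level χ.primitiveCharacter
    (Or.inr h)
  rw [DirichletCharacter.changeLevel_primitiveCharacter] at h1
  rw [h1, norm_mul, mul_comm, norm_prod]
  gcongr with p hp
  have hp' := Nat.prime_of_mem_primeFactors hp
  have h2 : ‖(p : ℂ) ^ (-(1 / 2 + t * I : ℂ))‖ ≤ 1 := by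
    rw [Complex.norm_natCast_cpow_of_pos hp'.pos]
    exact Real.rpow_le_one_of_one_le_of_nonpos (by exact_mod_cast hp'.one_lt.le) (by simp)
  calc _ ≤ ‖(1 : ℂ)‖ + ‖χ.primitiveCharacter p * (p : ℂ) ^ (-(1 / 2 + t * I : ℂ))‖ :=
        norm_sub_le _ _
    _ ≤ 1 + 1 * 1 := by
        rw [norm_one, norm_mul]
        gcongr
        exact χ.primitiveCharacter.norm_le_one p
    _ = 2 := by norm_num

lemma one_le_log_of_three_le {T : ℝ} (hT : 3 ≤ T) : 1 ≤ Real.log T := by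
  rw [Real.le_log_iff_exp_le (by linarith)]
  linarith [Real.exp_one_lt_d9]

/-- Mean square of a product of two Dirichlet L-functions on the critical line. The exponent of
the logarithm is the order of the singularity at `1` of the series of squared coefficients. -/
theorem exists_integral_norm_sq_LFunction_mul_le {q : ℕ} [NeZero q] (χ ψ : DirichletCharacter ℂ q)
    {k : ℕ} (hk : ∃ C : ℝ, 0 < C ∧ ∀ σ : ℝ, 1 < σ → σ ≤ 2 →
      ∑' n : ℕ, ‖charConv χ.primitiveCharacter ψ.primitiveCharacter n‖ ^ 2 * (n : ℝ) ^ (-σ) ≤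
        C * (1 / (σ - 1)) ^ k) :
    ∃ K, 0 < K ∧ ∀ T : ℝ, 3 ≤ T →
      ∫ t in T..(2 * T), ‖χ.LFunction (1 / 2 + t * I) * ψ.LFunction (1 / 2 + t * I)‖ ^ 2 ≤
        K * T * Real.log T ^ k := by
  have : NeZero χ.conductor := ⟨χ.conductor_ne_zero⟩
  have : NeZero ψ.conductor := ⟨ψ.conductor_ne_zero⟩
  obtain ⟨C, hC, hser⟩ := hk
  obtain ⟨E₁, hE₁, h₁⟩ := exists_norm_LFunction_le_primitiveCharacter χ
  obtain ⟨E₂, hE₂, h₂⟩ := exists_norm_LFunction_le_primitiveCharacter ψ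
  obtain ⟨K, hK, hmain⟩ := exists_integral_norm_sq_LFunction_mul_le_of_isPrimitive
    χ.primitiveCharacter_isPrimitive ψ.primitiveCharacter_isPrimitive
  refine ⟨(E₁ * E₂) ^ 2 * (K * C), by positivity, fun T hT => ?_⟩
  have hT0 : 0 < T := by linarith
  have hlog := one_le_log_of_three_le hT
  have h3 := hser (1 + 1 / Real.log T) (by linarith [one_div_pos.2 (by linarith : 0 < Real.log T)])
    (by linarith [(div_le_one (by linarith : 0 < Real.log T)).2 hlog])
  rw [add_sub_cancel_left, one_div_one_div] at h3
  calc _ ≤ ∫ t in T..(2 * T), (E₁ * E₂) ^ 2 * ‖χ.primitiveCharacter.LFunction (1 / 2 + t * I) *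
        ψ.primitiveCharacter.LFunction (1 / 2 + t * I)‖ ^ 2 := by
        refine intervalIntegral.integral_mono_on (by linarith)
          (Continuous.intervalIntegrable ?_ _ _) (Continuous.intervalIntegrable ?_ _ _)
          fun t _ => ?_
        · exact (((continuous_LFunction_critical_line χ).mul
            (continuous_LFunction_critical_line ψ)).norm).pow 2
        · exact ((((continuous_LFunction_critical_line _).mul
            (continuous_LFunction_critical_line _)).norm).pow 2).const_mul _
        · rw [← mul_pow, norm_mul, norm_mul, mul_mul_mul_comm]
          gcongr
          exacts [h₁ t, h₂ t]
    _ = (E₁ * E₂) ^ 2 * ∫ t in T..(2 * T), ‖χ.primitiveCharacter.LFunction (1 / 2 + t * I) *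
        ψ.primitiveCharacter.LFunction (1 / 2 + t * I)‖ ^ 2 :=
        intervalIntegral.integral_const_mul _ _
    _ ≤ (E₁ * E₂) ^ 2 * (K * T * (C * Real.log T ^ k)) := by
        gcongr
        exact (hmain T hT).trans (by gcongr)
    _ = _ := by ring

lemma exists_integral_norm_sq_LFunction_mul_le_log_pow_four {q : ℕ} [NeZero q]
    (χ ψ : DirichletCharacter ℂ q) : ∃ K, 0 < K ∧ ∀ T : ℝ, 3 ≤ T →
      ∫ t in T..(2 * T), ‖χ.LFunction (1 / 2 + t * I) * ψ.LFunction (1 / 2 + t * I)‖ ^ 2 ≤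
        K * T * Real.log T ^ 4 := by
  have : NeZero χ.conductor := ⟨χ.conductor_ne_zero⟩
  have : NeZero ψ.conductor := ⟨ψ.conductor_ne_zero⟩
  obtain ⟨C, hC, h⟩ := exists_tsum_norm_sq_charConv_le χ.primitiveCharacter ψ.primitiveCharacter
  exact exists_integral_norm_sq_LFunction_mul_le χ ψ ⟨C, hC, fun σ h1 h2 => (h σ h1 h2).2⟩

lemma exists_integral_norm_sq_LFunction_mul_le_log_sq {q : ℕ} [NeZero q]
    {χ ψ : DirichletCharacter ℂ q} (hne : χ ≠ ψ) : ∃ K, 0 < K ∧ ∀ T : ℝ, 3 ≤ T →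
      ∫ t in T..(2 * T), ‖χ.LFunction (1 / 2 + t * I) * ψ.LFunction (1 / 2 + t * I)‖ ^ 2 ≤
        K * T * Real.log T ^ 2 := by
  have : NeZero χ.conductor := ⟨χ.conductor_ne_zero⟩
  have : NeZero ψ.conductor := ⟨ψ.conductor_ne_zero⟩
  exact exists_integral_norm_sq_LFunction_mul_le χ ψ
    (exists_tsum_norm_sq_charConv_le_of_ne _ _ χ.conductor_dvd_level ψ.conductor_dvd_level
      (by rwa [DirichletCharacter.changeLevel_primitiveCharacter,
        DirichletCharacter.changeLevel_primitiveCharacter]))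

lemma eq_two_or_exists_pair_of_sum_eq_two {ι : Type*} [Fintype ι] [DecidableEq ι]
    {ℓ : ι → ℕ}
    (h : ∑ i, ℓ i = 2) : (∃ i, ℓ = fun j => if j = i then 2 else 0) ∨
      ∃ i j, i ≠ j ∧ ℓ i = 1 ∧ ℓ j = 1 ∧ ∀ k, k ≠ i ∧ k ≠ j → ℓ k = 0 := by
  obtain ⟨i, -, hi⟩ := Finset.exists_ne_zero_of_sum_ne_zero (h.trans_ne two_ne_zero)
  have h1 := Finset.add_sum_erase univ ℓ (mem_univ i)
  rw [h] at h1
  obtain h2 | h2 : ℓ i = 2 ∨ ℓ i = 1 := by omega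
  · left
    refine ⟨i, funext fun j => ?_⟩
    split_ifs with hj
    · rw [hj, h2]
    · exact Finset.sum_eq_zero_iff.1 (by omega : ∑ x ∈ univ.erase i, ℓ x = 0) j (by simp [hj])
  · right
    have h3 : ∑ x ∈ univ.erase i, ℓ x = 1 := by omega
    obtain ⟨j, hj, hj0⟩ := Finset.exists_ne_zero_of_sum_ne_zero (h3.trans_ne one_ne_zero)
    have h4 := Finset.add_sum_erase _ ℓ hj
    rw [h3] at h4
    have h5 : ∑ x ∈ (univ.erase i).erase j, ℓ x = 0 := by omega
    refine ⟨i, j, (Finset.ne_of_mem_erase hj).symm, h2, by omega, fun k hk => ?_⟩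
    exact Finset.sum_eq_zero_iff.1 h5 k (by simp [hk])

lemma Ll_eq_mul_self {q : ℕ} [NeZero q] (χ : DirichletCharacter ℂ q) (s : ℂ) :
    Ll (fun ν => if ν = χ then 2 else 0) s = χ.LFunction s * χ.LFunction s := by
  rw [Ll, Finset.prod_eq_single χ (fun ν _ h => by simp [h]) (by simp), if_pos rfl, sq]

lemma Ll_eq_mul {q : ℕ} [NeZero q] {ℓ : DirichletCharacter ℂ q → ℕ} {χ ψ : DirichletCharacter ℂ q}
    (hne : χ ≠ ψ) (hχ : ℓ χ = 1) (hψ : ℓ ψ = 1) (h : ∀ ν, ν ≠ χ ∧ ν ≠ ψ → ℓ ν = 0) (s : ℂ) :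
    Ll ℓ s = χ.LFunction s * ψ.LFunction s := by
  rw [Ll, Finset.prod_eq_mul χ ψ hne (fun ν _ hν => by simp [h ν hν]) (by simp) (by simp), hχ, hψ,
    pow_one, pow_one]

lemma continuous_Ll_critical_line {q : ℕ} [NeZero q] (ℓ : DirichletCharacter ℂ q → ℕ) :
    Continuous fun t : ℝ => Ll ℓ (1 / 2 + t * I) :=
  continuous_finsetProd _ fun χ _ => (continuous_LFunction_critical_line χ).pow _

lemma exists_integral_norm_sq_Ll_le_log_pow_four {q : ℕ} [NeZero q]
    {ℓ : DirichletCharacter ℂ q → ℕ} (h : ∑ χ, ℓ χ = 2) : ∃ K, 0 < K ∧ ∀ T : ℝ, 3 ≤ T →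
      ∫ t in T..(2 * T), ‖Ll ℓ (1 / 2 + t * I)‖ ^ 2 ≤ K * T * Real.log T ^ 4 := by
  rcases eq_two_or_exists_pair_of_sum_eq_two h with ⟨χ, rfl⟩ | ⟨χ, ψ, hne, hχ, hψ, h0⟩
  · simp only [Ll_eq_mul_self]
    exact exists_integral_norm_sq_LFunction_mul_le_log_pow_four χ χ
  · simp only [Ll_eq_mul hne hχ hψ h0]
    exact exists_integral_norm_sq_LFunction_mul_le_log_pow_four χ ψ

lemma exists_integral_norm_sq_Ll_le_log_sq {q : ℕ} [NeZero q]
    {ℓ : DirichletCharacter ℂ q → ℕ} (h : ∑ χ, ℓ χ = 2)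
    (hℓ : ∀ χ : DirichletCharacter ℂ q, ℓ ≠ fun ν => if ν = χ then 2 else 0) :
    ∃ K, 0 < K ∧ ∀ T : ℝ, 3 ≤ T →
      ∫ t in T..(2 * T), ‖Ll ℓ (1 / 2 + t * I)‖ ^ 2 ≤ K * T * Real.log T ^ 2 := by
  rcases eq_two_or_exists_pair_of_sum_eq_two h with ⟨χ, hχ⟩ | ⟨χ, ψ, hne, hχ, hψ, h0⟩
  · exact absurd hχ (hℓ χ)
  · simp only [Ll_eq_mul hne hχ hψ h0]
    exact exists_integral_norm_sq_LFunction_mul_le_log_sq hne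

/-- A weighted form of the Cauchy-Schwarz inequality on dyadic intervals. -/
lemma integral_norm_mul_norm_le {A B : ℝ → ℂ} (hA : Continuous A) (hB : Continuous B)
    {T K₁ K₂ : ℝ} (hT : 3 ≤ T)
    (h₁ : ∫ t in T..(2 * T), ‖A t‖ ^ 2 ≤ K₁ * T * Real.log T ^ 2)
    (h₂ : ∫ t in T..(2 * T), ‖B t‖ ^ 2 ≤ K₂ * T * Real.log T ^ 4) :
    ∫ t in T..(2 * T), ‖A t‖ * ‖B t‖ ≤ (K₁ + K₂) * T * Real.log T ^ 3 := by
  have hlog : 0 < Real.log T := by linarith [one_le_log_of_three_le hT]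
  have hi₁ : IntervalIntegrable (fun t => ‖A t‖ ^ 2) volume T (2 * T) :=
    (hA.norm.pow 2).intervalIntegrable _ _
  have hi₂ : IntervalIntegrable (fun t => ‖B t‖ ^ 2) volume T (2 * T) :=
    (hB.norm.pow 2).intervalIntegrable _ _
  calc _ ≤ ∫ t in T..(2 * T), (Real.log T * ‖A t‖ ^ 2 + (Real.log T)⁻¹ * ‖B t‖ ^ 2) := by
        refine intervalIntegral.integral_mono_on (by linarith)
          ((hA.norm.mul hB.norm).intervalIntegrable _ _)
          ((hi₁.const_mul _).add (hi₂.const_mul _)) fun t _ => ?_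
        rw [← mul_le_mul_iff_right₀ hlog, mul_add, mul_inv_cancel_left₀ hlog.ne']
        nlinarith [sq_nonneg (Real.log T * ‖A t‖ - ‖B t‖), sq_nonneg (Real.log T * ‖A t‖),
          sq_nonneg ‖B t‖]
    _ = Real.log T * (∫ t in T..(2 * T), ‖A t‖ ^ 2) +
        (Real.log T)⁻¹ * ∫ t in T..(2 * T), ‖B t‖ ^ 2 := by
        rw [intervalIntegral.integral_add (hi₁.const_mul _) (hi₂.const_mul _),
          intervalIntegral.integral_const_mul, intervalIntegral.integral_const_mul]
    _ ≤ Real.log T * (K₁ * T * Real.log T ^ 2) + (Real.log T)⁻¹ * (K₂ * T * Real.log T ^ 4) := by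
        gcongr
    _ = _ := by
        field_simp

/-- Minor off-diagonal bound for `k = 2`: if `|ℓ⁽¹⁾| = |ℓ⁽²⁾| = 2`,
`ℓ⁽¹⁾ ≠ ℓ⁽²⁾`, and at least one of them is not of the form `2δ^χ`, then
`|∫_T^{2T} 𝓛^{ℓ⁽¹⁾}(1/2+it) conj(𝓛^{ℓ⁽²⁾}(1/2+it)) dt| ≪_q T (log T)³`. -/
theorem minor_offdiagonal_bound (q : ℕ) [NeZero q] (ℓ₁ ℓ₂ : DirichletCharacter ℂ q → ℕ)
    (h1 : ∑ χ : DirichletCharacter ℂ q, ℓ₁ χ = 2)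
    (h2 : ∑ χ : DirichletCharacter ℂ q, ℓ₂ χ = 2)
    (hne : ℓ₁ ≠ ℓ₂)
    (hminor : (∀ χ : DirichletCharacter ℂ q, ℓ₁ ≠ fun ν => if ν = χ then 2 else 0) ∨
              (∀ χ : DirichletCharacter ℂ q, ℓ₂ ≠ fun ν => if ν = χ then 2 else 0)) :
    ∃ C T₀ : ℝ, ∀ T : ℝ, T₀ ≤ T →
      ‖∫ t in T..(2*T),
          Ll ℓ₁ (1/2 + t * Complex.I) * starRingEnd ℂ (Ll ℓ₂ (1/2 + t * Complex.I))‖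
        ≤ C * T * Real.log T ^ 3 := by
  have hnorm (T : ℝ) (hT : 3 ≤ T) : ‖∫ t in T..(2*T),
      Ll ℓ₁ (1/2 + t * Complex.I) * starRingEnd ℂ (Ll ℓ₂ (1/2 + t * Complex.I))‖ ≤
      ∫ t in T..(2 * T), ‖Ll ℓ₁ (1 / 2 + t * I)‖ * ‖Ll ℓ₂ (1 / 2 + t * I)‖ := by
    refine (intervalIntegral.norm_integral_le_integral_norm (by linarith)).trans (le_of_eq ?_)
    simp only [norm_mul, RCLike.norm_conj]
  have hc₁ := continuous_Ll_critical_line ℓ₁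
  have hc₂ := continuous_Ll_critical_line ℓ₂
  rcases hminor with h | h
  · obtain ⟨K₁, -, hK₁⟩ := exists_integral_norm_sq_Ll_le_log_sq h1 h
    obtain ⟨K₂, -, hK₂⟩ := exists_integral_norm_sq_Ll_le_log_pow_four h2
    exact ⟨K₁ + K₂, 3, fun T hT => (hnorm T hT).trans
      (integral_norm_mul_norm_le hc₁ hc₂ hT (hK₁ T hT) (hK₂ T hT))⟩
  · obtain ⟨K₁, -, hK₁⟩ := exists_integral_norm_sq_Ll_le_log_sq h2 h
    obtain ⟨K₂, -, hK₂⟩ := exists_integral_norm_sq_Ll_le_log_pow_four h1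
    refine ⟨K₁ + K₂, 3, fun T hT => (hnorm T hT).trans ?_⟩
    simp only [mul_comm ‖Ll ℓ₁ _‖]
    exact integral_norm_mul_norm_le hc₂ hc₁ hT (hK₁ T hT) (hK₂ T hT)
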